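/- arXiv:1305.0440 — 5 statements merged into one kernel-verified Lean document; each statement's English description precedes it below -/
import Mathlib

section
/- Let a1, a2, a3 be real numbers with a1*a2*a3 ≠ 0 and A = a1*a2 + a1*a3 + a2*a3 ≠ 0. If there exist positive reals x1, x2, x3 satisfying system (S) together with F2(x1,x2,x3) = 0 (i.e., the corresponding singular point of the reduced planar Ricci flow system is degenerate), then Q(a1,a2,a3) = 0. -/
noncomputable section
open Real Set

/-- `A = a1*a2 + a1*a3 + a2*a3`. -/
def AA (a1 a2 a3 : ℝ) : ℝ := a1*a2 + a1*a3 + a2*a3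

/-- First equation of system (S). -/
def eqS1 (a1 a2 a3 x1 x2 x3 : ℝ) : Prop :=
  (a2 + a3)*(a1*x2^2 + a1*x3^2 - x2*x3) + (a2*x2 + a3*x3)*x1
    - (a1*a2 + a1*a3 + 2*a2*a3)*x1^2 = 0

/-- Second equation of system (S). -/
def eqS2 (a1 a2 a3 x1 x2 x3 : ℝ) : Prop :=
  (a1 + a3)*(a2*x1^2 + a2*x3^2 - x1*x3) + (a1*x1 + a3*x3)*x2
    - (a1*a2 + 2*a1*a3 + a2*a3)*x2^2 = 0

/-- The quantity `F2` (determinant numerator). -/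
def F2 (a1 a2 a3 x1 x2 x3 : ℝ) : ℝ :=
  let A := a1*a2 + a1*a3 + a2*a3
  (a1^2*a2*a3*(2*A + a2*a3) - A^3)*x1^4 + (a1*a2^2*a3*(2*A + a1*a3) - A^3)*x2^4
  + (a1*a2*a3^2*(2*A + a1*a2) - A^3)*x3^4
  - 2*a1^2*(A + a2*a3)*(a2*x2 + a3*x3)*x1^3
  - 2*a2^2*(A + a1*a3)*(a1*x1 + a3*x3)*x2^3
  - 2*a3^2*(A + a1*a2)*(a2*x2 + a1*x1)*x3^3
  + (a1*a2*(2*(3*a1*a2 + a2^2 + a1^2)*a3^2 + 2*(a1 + a2)*a1*a2*a3 + a1*a2) + 2*A^3)*x1^2*x2^2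
  + (a1*a3*(2*(3*a1*a3 + a3^2 + a1^2)*a2^2 + 2*(a1 + a3)*a1*a2*a3 + a1*a3) + 2*A^3)*x1^2*x3^2
  + (a2*a3*(2*(3*a2*a3 + a3^2 + a2^2)*a1^2 + 2*(a2 + a3)*a1*a2*a3 + a2*a3) + 2*A^3)*x2^2*x3^2
  - 2*a1*a2*a3*((A + a2*a3 - a1)*x1 + (A + a1*a3 - a2)*x2 + (A + a1*a2 - a3)*x3)*x1*x2*x3

/-- The degeneration polynomial `Q`. -/
def Qpoly (a1 a2 a3 : ℝ) : ℝ :=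
  let s1 := a1 + a2 + a3
  let s2 := a1*a2 + a1*a3 + a2*a3
  let s3 := a1*a2*a3
  (2*s1 + 4*s3 - 1)*(64*s1^5 - 64*s1^4 + 8*s1^3 + 12*s1^2 - 6*s1 + 1
      + 240*s3*s1^2 - 240*s3*s1 - 1536*s3^2*s1 - 4096*s3^3 + 60*s3 + 768*s3^2)
  - 8*s1*(2*s1 + 4*s3 - 1)*(2*s1 - 32*s3 - 1)*(10*s1 + 32*s3 - 5)*s2
  - 16*s1^2*(13 - 52*s1 + 640*s3*s1 + 1024*s3^2 - 320*s3 + 52*s1^2)*s2^2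
  + 64*(2*s1 - 1)*(2*s1 - 32*s3 - 1)*s2^3 + 2048*s1*(2*s1 - 1)*s2^4


/-- A binary cubic whose two partial derivatives vanish at a nonzero point has zero discriminant. -/
lemma cubic_disc_zero (α β γ δ p q : ℝ) (hpq : p ≠ 0 ∨ q ≠ 0)
    (h1 : 3*α*p^2 + 2*β*p*q + γ*q^2 = 0) (h2 : β*p^2 + 2*γ*p*q + 3*δ*q^2 = 0) :
    β^2*γ^2 - 4*α*γ^3 - 4*β^3*δ - 27*α^2*δ^2 + 18*α*β*γ*δ = 0 := by
  by_cases hp : p = 0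
  · have hq : q ≠ 0 := by rcases hpq with h | h
                          · exact absurd hp h
                          · exact h
    subst hp
    have hg : γ = 0 := by simpa [hq] using h1
    have hd : δ = 0 := by simpa [hq] using h2
    subst hg hd
    ring
  by_cases hq : q = 0
  · subst hq
    have hg : α = 0 := by simpa [hp] using h1
    have hd : β = 0 := by simpa [hp] using h2
    subst hg hd
    ring
  have hm : (9*α*δ - β*γ)*p + (6*β*δ - 2*γ^2)*q = 0 := by
    apply mul_left_cancel₀ hp
    linear_combination 3*δ*h1 - γ*h2
  have hl : (6*α*γ - 2*β^2)*p + (9*α*δ - β*γ)*q = 0 := by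
    apply mul_left_cancel₀ hq
    linear_combination 3*α*h2 - β*h1
  apply mul_left_cancel₀ hp
  linear_combination (-1/3)*(9*α*δ - β*γ)*hm + (1/3)*(6*β*δ - 2*γ^2)*hl

/-- Mixed determinant: derivative of the determinant of the symmetric matrix `m` in the
direction of `n`, when `m` has kernel vector `x` and `x` is isotropic for `n`. -/
lemma mixed_det_zero (m11 m22 m33 m12 m13 m23 n11 n22 n33 n12 n13 n23 x1 x2 x3 : ℝ)
    (hx3 : x3 ≠ 0)
    (k1 : m11*x1 + m12*x2 + m13*x3 = 0) (k2 : m12*x1 + m22*x2 + m23*x3 = 0)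
    (k3 : m13*x1 + m23*x2 + m33*x3 = 0)
    (hn : n11*x1^2 + n22*x2^2 + n33*x3^2 + 2*n12*x1*x2 + 2*n13*x1*x3 + 2*n23*x2*x3 = 0) :
    n11*(m22*m33 - m23^2) + n22*(m11*m33 - m13^2) + n33*(m11*m22 - m12^2)
      + 2*n12*(m13*m23 - m12*m33) + 2*n13*(m12*m23 - m13*m22)
      + 2*n23*(m12*m13 - m11*m23) = 0 := by
  have e13 : (m12*m23 - m13*m22)*x3 = (m11*m22 - m12^2)*x1 := by
    linear_combination m12*k2 - m22*k1
  have e23 : (m12*m13 - m11*m23)*x3 = (m11*m22 - m12^2)*x2 := by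
    linear_combination m12*k1 - m11*k2
  have e11 : (m22*m33 - m23^2)*x3 = (m12*m23 - m13*m22)*x1 := by
    linear_combination m22*k3 - m23*k2
  have e22 : (m11*m33 - m13^2)*x3 = (m12*m13 - m11*m23)*x2 := by
    linear_combination m11*k3 - m13*k1
  have e12 : (m13*m23 - m12*m33)*x3 = (m12*m23 - m13*m22)*x2 := by
    linear_combination m13*k2 - m12*k3
  apply mul_left_cancel₀ (pow_ne_zero 2 hx3)
  linear_combination n11*(x3*e11 + x1*e13) + n22*(x3*e22 + x2*e23)
    + 2*n12*(x3*e12 + x2*e13) + 2*n13*x3*e13 + 2*n23*x3*e23 + (m11*m22 - m12^2)*hn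

/-- A 2×2 system with zero determinant has a nonzero solution. -/
lemma exists_kernel (u1 u2 v1 v2 : ℝ) (h : u1*v2 - u2*v1 = 0) :
    ∃ p q : ℝ, (p ≠ 0 ∨ q ≠ 0) ∧ p*u1 + q*v1 = 0 ∧ p*u2 + q*v2 = 0 := by
  by_cases h1 : u1 = 0 ∧ v1 = 0
  · by_cases h2 : u2 = 0 ∧ v2 = 0
    · exact ⟨1, 0, by simp, by simp [h1.1], by simp [h2.1]⟩
    · refine ⟨v2, -u2, ?_, by simp [h1.1, h1.2], by ring⟩
      by_contra! hc
      exact h2 ⟨by simpa using hc.2, hc.1⟩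
  · refine ⟨v1, -u1, ?_, by ring, by linear_combination -h⟩
    by_contra! hc
    exact h1 ⟨by simpa using hc.2, hc.1⟩

theorem degenerate_singular_point_implies_Q_zero (a1 a2 a3 : ℝ)
    (ha : a1*a2*a3 ≠ 0) (hA : AA a1 a2 a3 ≠ 0)
    (h : ∃ x1 x2 x3 : ℝ, 0 < x1 ∧ 0 < x2 ∧ 0 < x3 ∧
      eqS1 a1 a2 a3 x1 x2 x3 ∧ eqS2 a1 a2 a3 x1 x2 x3 ∧ F2 a1 a2 a3 x1 x2 x3 = 0) :
    Qpoly a1 a2 a3 = 0 := by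
  obtain ⟨x1, x2, x3, hx1, hx2, hx3, hS1, hS2, hF⟩ := h
  unfold AA at hA
  unfold eqS1 at hS1
  unfold eqS2 at hS2
  -- The Einstein equations `R1 = R3`, `R2 = R3`.
  have E1 : (x2*x3 + a1*(x1^2 - x2^2 - x3^2)) - (x1*x2 + a3*(x3^2 - x1^2 - x2^2)) = 0 := by
    apply mul_left_cancel₀ hA
    linear_combination -(a1 + a3)*hS1 - a3*hS2
  have E2 : (x1*x3 + a2*(x2^2 - x1^2 - x3^2)) - (x1*x2 + a3*(x3^2 - x1^2 - x2^2)) = 0 := by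
    apply mul_left_cancel₀ hA
    linear_combination -a3*hS1 - (a2 + a3)*hS2
  -- Degeneracy: the gradients are linearly dependent.
  have J : (2*(a1+a3)*x1 - x2)*(-x1 + 2*(a2+a3)*x2)
      - (-x1 + 2*(a3-a1)*x2 + x3)*(2*(a3-a2)*x1 - x2 + x3) = 0 := by
    have hne : (a1*a2 + a1*a3 + a2*a3)^2*x1*x2 ≠ 0 :=
      mul_ne_zero (mul_ne_zero (pow_ne_zero 2 hA) hx1.ne') hx2.ne'
    apply mul_left_cancel₀ hne
    simp only [F2] at hF
    linear_combination hF
      - (((1)*a2^2*a3^2)*x2*x3 + ((1)*a2^2*a3^2 + (2)*a1*a2*a3^2 + (4)*a1*a2^2*a3 + (2)*a1^2*a2*a3 +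
      (2)*a1^2*a3^2)*x1*x2 + ((-5)*a1*a2^2*a3^2 + (-1)*a2^3*a3^2 + (-1)*a1^2*a2^2*a3 +
      (-1)*a1^2*a3^3 + (-1)*a1^2*a2^3 + (-1)*a1^2*a2*a3^2)*x1^2 + ((-2)*a2^2*a3^3 + (-3)*a2^3*a3^2
      + (-4)*a1*a2*a3^3 + (-11)*a1*a2^2*a3^2 + (-6)*a1*a2^3*a3 + (-7)*a1^2*a2*a3^2 +
      (-1)*a1^2*a2^3 + (-3)*a1^2*a3^3 + (-5)*a1^2*a2^2*a3)*x2^2 + ((1)*a2^3*a3^2 + (2)*a1*a2*a3^3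
      + (5)*a1*a2^2*a3^2 + (4)*a1*a2^3*a3 + (7)*a1^2*a2*a3^2 + (1)*a1^2*a2^3 + (3)*a1^2*a3^3 +
      (5)*a1^2*a2^2*a3)*x3^2 + ((-2)*a1*a2^2*a3 + (-2)*a1^2*a2*a3 + (-2)*a1^2*a3^2)*x1*x3)*E1
      - (((-1)*a2^2*a3^2 + (-2)*a1*a2*a3^2 + (-4)*a1*a2^2*a3 + (-1)*a1^2*a2^2 + (-2)*a1^2*a2*a3 +
      (-2)*a1^2*a3^2)*x1*x2 + ((1)*a2^2*a3^2 + (4)*a1*a2*a3^2 + (4)*a1*a2^2*a3 + (1)*a1^2*a2^2 +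
      (3)*a1^2*a3^2 + (4)*a1^2*a2*a3)*x2*x3 + ((2)*a2^2*a3^3 + (4)*a1*a2*a3^3 + (2)*a1*a2^2*a3^2 +
      (-6)*a1^2*a2^2*a3 + (3)*a1^2*a3^3 + (-3)*a1^2*a2*a3^2 + (-2)*a1^3*a2^2 + (-4)*a1^3*a3^2 +
      (-6)*a1^3*a2*a3)*x2^2 + ((-2)*a1*a2*a3^3 + (-5)*a1^2*a2*a3^2 + (-2)*a1*a2^2*a3^2 +
      (-2)*a1^3*a3^2 + (-3)*a1^2*a3^3 + (-2)*a1^3*a2*a3 + (-2)*a1^2*a2^2*a3)*x3^2 +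
      ((-1)*a1^2*a2*a3^2 + (2)*a1*a2^2*a3^2 + (1)*a1^2*a3^3 + (2)*a1^2*a2^2*a3)*x1^2 +
      ((1)*a1^2*a3^2)*x1*x3)*E2
  obtain ⟨p, q, hpq, k1, k2⟩ := exists_kernel _ _ _ _ J
  have k3 : p*(x2 - 2*(a1+a3)*x3) + q*(x1 - 2*(a2+a3)*x3) = 0 := by
    apply mul_left_cancel₀ hx3.ne'
    linear_combination 2*p*E1 + 2*q*E2 - x1*k1 - x2*k2
  have D1 := mixed_det_zero (p*(2*(a1+a3)) + q*(2*(a3-a2))) (p*(2*(a3-a1)) + q*(2*(a2+a3)))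
    (p*(-2*(a1+a3)) + q*(-2*(a2+a3))) (-p-q) q p
    (2*(a1+a3)) (2*(a3-a1)) (-2*(a1+a3)) (-1) 0 1 x1 x2 x3 hx3.ne'
    (by linear_combination k1) (by linear_combination k2) (by linear_combination k3)
    (by linear_combination 2*E1)
  have D2 := mixed_det_zero (p*(2*(a1+a3)) + q*(2*(a3-a2))) (p*(2*(a3-a1)) + q*(2*(a2+a3)))
    (p*(-2*(a1+a3)) + q*(-2*(a2+a3))) (-p-q) q p
    (2*(a3-a2)) (2*(a2+a3)) (-2*(a2+a3)) (-1) 1 0 x1 x2 x3 hx3.ne'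
    (by linear_combination k1) (by linear_combination k2) (by linear_combination k3)
    (by linear_combination 2*E2)
  have D := cubic_disc_zero
    ((2*(a1+a3))*((2*(a3-a1))*(-2*(a1+a3)) - 1^2) - (-1)*((-1)*(-2*(a1+a3)) - 1*0)
      + 0*((-1)*1 - (2*(a3-a1))*0))
    ((2*(a3-a2))*((2*(a3-a1))*(-2*(a1+a3)) - 1^2) + (2*(a2+a3))*((2*(a1+a3))*(-2*(a1+a3)) - 0^2)
      + (-2*(a2+a3))*((2*(a1+a3))*(2*(a3-a1)) - (-1)^2) + 2*(-1)*(0*1 - (-1)*(-2*(a1+a3)))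
      + 2*1*((-1)*1 - 0*(2*(a3-a1))) + 2*0*((-1)*0 - (2*(a1+a3))*1))
    ((2*(a1+a3))*((2*(a2+a3))*(-2*(a2+a3)) - 0^2) + (2*(a3-a1))*((2*(a3-a2))*(-2*(a2+a3)) - 1^2)
      + (-2*(a1+a3))*((2*(a3-a2))*(2*(a2+a3)) - (-1)^2) + 2*(-1)*(1*0 - (-1)*(-2*(a2+a3)))
      + 2*0*((-1)*0 - 1*(2*(a2+a3))) + 2*1*((-1)*1 - (2*(a3-a2))*0))
    ((2*(a3-a2))*((2*(a2+a3))*(-2*(a2+a3)) - 0^2) - (-1)*((-1)*(-2*(a2+a3)) - 0*1)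
      + 1*((-1)*0 - (2*(a2+a3))*1))
    p q hpq (by linear_combination D1) (by linear_combination D2)
  simp only [Qpoly]
  linear_combination (-1/16)*D
end
end

section
/- Let a1, a2, a3 ∈ (0, 1/2]. There exist positive reals x1, x2, x3 satisfying system (S) together with F1(x1,x2,x3) = 0 and F2(x1,x2,x3) = 0 (i.e., the reduced planar Ricci flow system has a singular point with ρ = 0 and δ = 0) if and only if a1 = a2 = a3 = 1/4. -/
noncomputable section
open Real Set

/-- The quantity `F1` (trace numerator). -/
def F1 (a1 a2 a3 x1 x2 x3 : ℝ) : ℝ :=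
  a1*a2*x1*x2 + a1*a3*x1*x3 + a2*a3*x2*x3
    - (AA a1 a2 a3 + a2*a3)*a1*x1^2 - (AA a1 a2 a3 + a1*a3)*a2*x2^2
    - (AA a1 a2 a3 + a1*a2)*a3*x3^2

/-- Criticality and Hessian conditions attached to one pair of indices. -/
def PairCond (a b x y z : ℝ) : Prop :=
  (b - a)*z^2 = (y - x)*((a+b)*(x+y) - z) ∧
  (a-b)^2*(x^2+y^2+z^2) + 4*a*b*(x^2+y^2) = z*(a*y+b*x)

theorem PairCond.swap {a b x y z : ℝ} (h : PairCond a b x y z) : PairCond b a y x z := by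
  obtain ⟨h1, h2⟩ := h
  exact ⟨by linarith, by linarith⟩

theorem PairCond.le {a b x y z : ℝ} (h : PairCond a b x y z) (ha : 0 < a) (hb : 0 < b)
    (hx : 0 < x) (hy : 0 < y) (hz : 0 < z) : (a+b)*(x+y) ≤ z := by
  obtain ⟨hC, hH⟩ := h
  by_contra hlt
  push Not at hlt
  have hG : (b-a)*(y-x)*(2*((a+b)*(x+y)) - z)
      = -((a+b)*(x+y)*((a+b)*(x+y) - z)) - (a+b)^2*(y-x)^2 := by
    linear_combination 2*hH - 2*(b-a)*hC
  have h1 : 0 ≤ (b-a)*(y-x) := by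
    have h2 : (b-a)*(y-x)*z^2 = (y-x)^2*((a+b)*(x+y) - z) := by linear_combination (y-x)*hC
    have h3 : 0 ≤ (b-a)*(y-x)*z^2 := by
      rw [h2]; exact mul_nonneg (sq_nonneg _) (by linarith)
    exact nonneg_of_mul_nonneg_left h3 (by positivity)
  have h4 : 0 ≤ (b-a)*(y-x)*(2*((a+b)*(x+y)) - z) := mul_nonneg h1 (by linarith)
  have h5 : 0 < (a+b)*(x+y)*((a+b)*(x+y) - z) := mul_pos (by positivity) (by linarith)
  have h6 : 0 ≤ (a+b)^2*(y-x)^2 := by positivity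
  linarith

theorem PairCond.eq_of_eq {a b x y z : ℝ} (h : PairCond a b x y z) (ha : 0 < a) (hb : 0 < b)
    (hx : 0 < x) (hz : 0 < z) (hxy : x = y) : a = b ∧ (a+b)*(x+y) = z := by
  obtain ⟨hC, hH⟩ := h
  subst hxy
  have hab : a = b := by
    have : (b-a)*z^2 = 0 := by rw [hC]; ring
    have hz2 : z^2 ≠ 0 := by positivity
    have := (mul_eq_zero.mp this).resolve_right hz2
    linarith
  subst hab
  refine ⟨rfl, ?_⟩
  have h0 : (2*a*x)*((a+a)*(x+x) - z) = 0 := by linear_combination hH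
  have h1 : 2*a*x ≠ 0 := by positivity
  have := (mul_eq_zero.mp h0).resolve_left h1
  linarith

theorem PairCond.bound_aux {a b x y z : ℝ} (h : PairCond a b x y z) (ha : 0 < a) (hb : 0 < b)
    (hx : 0 < x) (hy : 0 < y) (hz : 0 < z) (hxy : x < y) :
    (z - (a+b)*(x+y))*(x+y) ≤ (a+b)*(y-x)^2 := by
  have hle := h.le ha hb hx hy hz
  obtain ⟨hC, hH⟩ := h
  obtain ⟨p, hp⟩ : ∃ p, p = x + y := ⟨_, rfl⟩
  obtain ⟨m, hm⟩ : ∃ m, m = y - x := ⟨_, rfl⟩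
  obtain ⟨σ, hσ⟩ : ∃ σ, σ = a + b := ⟨_, rfl⟩
  obtain ⟨s, hs⟩ : ∃ s, s = σ * p := ⟨_, rfl⟩
  have hE : z^2*(s*(z-s) - σ^2*m^2) = m^2*(z-s)*(z-2*s) := by
    subst hs; subst hp; subst hm; subst hσ
    linear_combination (-2*z^2)*hH + ((y-x)*(2*(a+b)*(x+y)-z) + 2*(b-a)*z^2)*hC
  have hpos : m*(z-s) < σ*z^2 := by
    have h1 : m*(z-s) = (a-b)*z^2 := by
      subst hs; subst hp; subst hm; subst hσ
      linear_combination hC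
    rw [h1]
    exact mul_lt_mul_of_pos_right (by linarith) (by positivity)
  rw [← hp, ← hm, ← hσ, ← hs]
  rw [← hp, ← hσ, ← hs] at hle
  have hm0 : 0 < m := by linarith
  have hp0 : 0 < p := by linarith
  have hmp : m < p := by linarith
  have hσ0 : 0 < σ := by linarith
  have hs0 : 0 < s := by rw [hs]; positivity
  by_contra hcon
  push Not at hcon
  have h1 : 0 < s*(z-s) - σ^2*m^2 := by
    have : s*(z-s) - σ^2*m^2 = σ*((z-s)*p - σ*m^2) := by rw [hs]; ring
    rw [this]; exact mul_pos hσ0 (by linarith)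
  have h2 : 0 < m^2*(z-s)*(z-2*s) := by rw [← hE]; positivity
  have h3 : 0 < z - 2*s :=
    pos_of_mul_pos_right h2 (mul_nonneg (by positivity) (by linarith))
  -- multiply `hpos` by `m * p^2 * (z-2s)`
  have h4 : m*p^2*(z-2*s)*(m*(z-s)) < m*p^2*(z-2*s)*(σ*z^2) :=
    mul_lt_mul_of_pos_left hpos (by positivity)
  have h5 : (s*z^2)*((z-s)*p^2 - s*m^2 - m*p*(z-2*s)) < 0 := by
    have e1 : z^2*(s*(z-s)*p^2 - s^2*m^2) = p^2*(m^2*(z-s)*(z-2*s)) := by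
      rw [← hE, hs]; ring
    have e2 : m*p^2*(z-2*s)*(σ*z^2) = m*p*(z-2*s)*(s*z^2) := by
      have : s * p = σ * p^2 := by rw [hs]; ring
      linear_combination (-m*(z-2*s)*z^2)*this
    nlinarith
  have h6 : (z-s)*p^2 - s*m^2 - m*p*(z-2*s) = (z-s)*p*(p-m) + s*m*(p-m) := by ring
  have h7 : 0 ≤ (z-s)*p*(p-m) := mul_nonneg (mul_nonneg (by linarith) hp0.le) (by linarith)
  have h8 : 0 < s*m*(p-m) := mul_pos (by positivity) (by linarith)
  have h9 : 0 < (s*z^2)*((z-s)*p^2 - s*m^2 - m*p*(z-2*s)) := by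
    rw [h6]; exact mul_pos (by positivity) (by linarith)
  linarith

theorem ordered_case (a1 a2 a3 x1 x2 x3 : ℝ) (ha1 : 0 < a1) (ha2 : 0 < a2) (ha3 : 0 < a3)
    (hx1 : 0 < x1) (hx2 : 0 < x2) (hx3 : 0 < x3) (h12 : x1 ≤ x2) (h23 : x2 ≤ x3)
    (H1 : PairCond a2 a3 x2 x3 x1) (H2 : PairCond a1 a3 x1 x3 x2)
    (H3 : PairCond a1 a2 x1 x2 x3) : a1 = 1/4 ∧ a2 = 1/4 ∧ a3 = 1/4 := by
  have hl1 := H1.le ha2 ha3 hx2 hx3 hx1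
  rcases h23.lt_or_eq with hlt | heq
  · exfalso
    have hb := H1.bound_aux ha2 ha3 hx2 hx3 hx1 hlt
    have hC := H1.1
    have key : (a2-a3)*(2*a1*(x1^2+x2^2-x3^2) + (a2+a3)*(x1^2+x2^2+x3^2) - x1*x3)
        = a3*(x3-x2)*(x1+4*a1*(x2+x3)) := by
      linear_combination H3.2 - H2.2
    obtain ⟨f, hf⟩ : ∃ f, f = x3 - x2 := ⟨_, rfl⟩
    obtain ⟨p, hp⟩ : ∃ p, p = x2 + x3 := ⟨_, rfl⟩
    obtain ⟨g, hg⟩ : ∃ g, g = a2 - a3 := ⟨_, rfl⟩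
    obtain ⟨B, hB⟩ : ∃ B, B = 2*a1*(x1^2+x2^2-x3^2) + (a2+a3)*(x1^2+x2^2+x3^2) - x1*x3 :=
      ⟨_, rfl⟩
    have hf0 : 0 < f := by linarith
    have hp0 : 0 < p := by linarith
    rw [← hf, ← hp, ← hg, ← hB] at key
    rw [← hp] at hl1
    rw [← hp, ← hf] at hb
    have hgC : g*x1^2 = f*(x1 - (a2+a3)*p) := by rw [hg, hf, hp]; linear_combination -hC
    have hg0 : 0 ≤ g := by
      have : 0 ≤ g*x1^2 := by rw [hgC]; exact mul_nonneg hf0.le (by linarith)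
      exact nonneg_of_mul_nonneg_left this (by positivity)
    have hgB : 0 < g*B := by rw [key]; positivity
    have hB0 : 0 < B := pos_of_mul_pos_right hgB hg0
    have hBp : B*p ≤ 2*a1*p*(x1^2 - p*f) + x1*(x1^2 - x2*f) := by
      have e : 2*a1*p*(x1^2 - p*f) + x1*(x1^2 - x2*f) - B*p
          = (x1 - (a2+a3)*p)*(x1^2+x2^2+x3^2) := by
        rw [hB, hp, hf]; ring
      have : 0 ≤ (x1 - (a2+a3)*p)*(x1^2+x2^2+x3^2) := mul_nonneg (by linarith) (by positivity)
      linarith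
    have hpf : x2*f ≤ p*f := mul_le_mul_of_nonneg_right (by linarith) hf0.le
    have hxf : x2*f < x1^2 := by
      by_contra hcon
      push Not at hcon
      have t1 : 2*a1*p*(x1^2 - p*f) ≤ 0 :=
        mul_nonpos_of_nonneg_of_nonpos (by positivity) (by linarith)
      have t2 : x1*(x1^2 - x2*f) ≤ 0 :=
        mul_nonpos_of_nonneg_of_nonpos hx1.le (by linarith)
      have t3 : 0 < B*p := by positivity
      linarith
    have hfx : f < x1 := by
      have t : x1*f ≤ x2*f := mul_le_mul_of_nonneg_right h12 hf0.le
      have t' : x1*f < x1*x1 := by nlinarith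
      exact lt_of_mul_lt_mul_left t' hx1.le
    have hgp : g*p ≤ (a2+a3)*f := by
      have t1 : g*p*x1^2 ≤ (a2+a3)*f*f^2 := by
        have : g*p*x1^2 = f*((x1 - (a2+a3)*p)*p) := by linear_combination p*hgC
        rw [this]
        have := mul_le_mul_of_nonneg_left hb hf0.le
        linarith
      have t2 : (a2+a3)*f*f^2 ≤ (a2+a3)*f*x1^2 := by
        gcongr
      exact le_of_mul_le_mul_right (t1.trans t2) (by positivity)
    have hp3 : 3*f ≤ p := by linarith
    have hs3 : a2 + a3 ≤ 3*a3 := by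
      have t1 : g*(3*f) ≤ g*p := mul_le_mul_of_nonneg_left hp3 hg0
      have t2 : (3*g)*f ≤ (a2+a3)*f := by linarith
      have t3 := le_of_mul_le_mul_right t2 hf0
      linarith
    have hgp' : g*p ≤ 3*a3*f := hgp.trans (mul_le_mul_of_nonneg_right hs3 hf0.le)
    have hBp' : B*p ≤ 2*a1*p*x1^2 + x1^3 := by
      have t1 : 0 ≤ 2*a1*p*(p*f) := by positivity
      have t2 : 0 ≤ x1*(x2*f) := by positivity
      linarith
    have u1 : (g*p)*(B*p) ≤ (3*a3*f)*(2*a1*p*x1^2 + x1^3) :=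
      mul_le_mul hgp' hBp' (by positivity) (by positivity)
    have u2 : (g*p)*(B*p) = (a3*f)*(p^2*(x1+4*a1*p)) := by linear_combination p^2*key
    have hpx : 2*x1 ≤ p := by linarith
    have u3 : 4*x1^2 ≤ p^2 := by nlinarith
    have u4 : 3*(2*a1*p*x1^2 + x1^3) < p^2*(x1+4*a1*p) := by
      have v1 : (4*x1^2)*(x1+4*a1*p) ≤ p^2*(x1+4*a1*p) :=
        mul_le_mul_of_nonneg_right u3 (by positivity)
      have v2 : 0 < x1^3 := by positivity
      have v3 : 0 < a1*p*x1^2 := by positivity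
      linarith
    have u5 := mul_lt_mul_of_pos_left u4 (mul_pos ha3 hf0)
    linarith
  · obtain ⟨hab, hr⟩ := H1.eq_of_eq ha2 ha3 hx2 hx1 heq
    subst hab
    subst heq
    rcases h12.lt_or_eq with hlt | heq
    · exfalso
      have hb := H3.bound_aux ha1 ha2 hx1 hx2 hx2 hlt
      have hC := H3.1
      have hy1 : 4*a2 < 1 := by
        have : (4*a2)*x2 < 1*x2 := by linarith
        exact lt_of_mul_lt_mul_right this hx2.le
      have hx : x1 = 4*a2*x2 := by linarith
      subst hx
      have hX : x2^2 ≠ 0 := by positivity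
      have e1 : (a1+a2)*(2-16*a2^2) = 1 - 2*a2 := by
        apply mul_right_cancel₀ hX
        linear_combination -hC
      have e2 : (1-(a1+a2)*(1+4*a2))*(1+4*a2) ≤ (a1+a2)*(1-4*a2)^2 := by
        have hX' : 0 < x2^2 := by positivity
        apply le_of_mul_le_mul_right _ hX'
        linarith
      have hN : 0 < 2-16*a2^2 := by nlinarith
      have e3 := mul_le_mul_of_nonneg_right e2 hN.le
      have e4 : (1-(a1+a2)*(1+4*a2))*(1+4*a2)*(2-16*a2^2)
          = (1-4*a2)*(1+2*a2)*(1+4*a2) := by linear_combination (-(1+4*a2)^2)*e1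
      have e5 : (a1+a2)*(1-4*a2)^2*(2-16*a2^2) = (1-4*a2)*((1-2*a2)*(1-4*a2)) := by
        linear_combination ((1-4*a2)^2)*e1
      rw [e4, e5] at e3
      have e6 : 0 < (1-4*a2)*(12*a2) := mul_pos (by linarith) (by positivity)
      linarith
    · obtain ⟨hab, hr'⟩ := H3.eq_of_eq ha1 ha2 hx1 hx2 heq
      subst hab
      subst heq
      have : a1 = 1/4 := by
        have : x1*(4*a1-1) = 0 := by linear_combination hr
        have := (mul_eq_zero.mp this).resolve_left hx1.ne'
        linarith
      exact ⟨this, this, this⟩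

theorem pairs_of_sys (a1 a2 a3 x1 x2 x3 : ℝ) (ha1 : 0 < a1) (ha2 : 0 < a2) (ha3 : 0 < a3)
    (hS1 : eqS1 a1 a2 a3 x1 x2 x3) (hS2 : eqS2 a1 a2 a3 x1 x2 x3)
    (hF1 : F1 a1 a2 a3 x1 x2 x3 = 0) (hF2 : F2 a1 a2 a3 x1 x2 x3 = 0) :
    PairCond a2 a3 x2 x3 x1 ∧ PairCond a1 a3 x1 x3 x2 ∧ PairCond a1 a2 x1 x2 x3 := by
  unfold eqS1 at hS1
  unfold eqS2 at hS2
  unfold F1 AA at hF1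
  unfold F2 at hF2
  simp only at hF2
  obtain ⟨t, ht⟩ : ∃ t, t = x1*x2 - a3*(x1^2+x2^2-x3^2) := ⟨_, rfl⟩
  have hA : a1*a2+a1*a3+a2*a3 ≠ 0 := by positivity
  have hP3 : x1*x2 = t + a3*(x1^2+x2^2-x3^2) := by linarith
  have hP1 : x2*x3 = t + a1*(x2^2+x3^2-x1^2) := by
    have : (a1*a2+a1*a3+a2*a3)*(x2*x3 - (t + a1*(x2^2+x3^2-x1^2))) = 0 := by
      rw [ht]; linear_combination -(a1+a3)*hS1 - a3*hS2
    have := (mul_eq_zero.mp this).resolve_left hA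
    linarith
  have hP2 : x1*x3 = t + a2*(x1^2+x3^2-x2^2) := by
    have : (a1*a2+a1*a3+a2*a3)*(x1*x3 - (t + a2*(x1^2+x3^2-x2^2))) = 0 := by
      rw [ht]; linear_combination -(a2+a3)*hS2 - a3*hS1
    have := (mul_eq_zero.mp this).resolve_left hA
    linarith
  clear ht
  obtain ⟨h1, hh1⟩ : ∃ h, h = x1*(a2*x3+a3*x2) - (a2+a3)^2*(x1^2+x2^2+x3^2) + 4*a2*a3*x1^2 :=
    ⟨_, rfl⟩
  obtain ⟨h2, hh2⟩ : ∃ h, h = x2*(a1*x3+a3*x1) - (a1+a3)^2*(x1^2+x2^2+x3^2) + 4*a1*a3*x2^2 :=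
    ⟨_, rfl⟩
  obtain ⟨h3, hh3⟩ : ∃ h, h = x3*(a1*x2+a2*x1) - (a1+a2)^2*(x1^2+x2^2+x3^2) + 4*a1*a2*x3^2 :=
    ⟨_, rfl⟩
  have htr : a1*h1+a2*h2+a3*h3 = 0 := by
    rw [hh1, hh2, hh3]
    linear_combination 2*hF1 + (a1*a2+a1*a3+a2*a3-3*a2*a3)*hP1
      + (a1*a2+a1*a3+a2*a3-3*a1*a3)*hP2 + (a1*a2+a1*a3+a2*a3-3*a1*a2)*hP3
  have hdet : 2*h1*h2+2*h1*h3+2*h2*h3-h1^2-h2^2-h3^2 = 0 := by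
    obtain ⟨q1, hq1⟩ : ∃ q, q = x1^2 := ⟨_, rfl⟩
    obtain ⟨q2, hq2⟩ : ∃ q, q = x2^2 := ⟨_, rfl⟩
    obtain ⟨q3, hq3⟩ : ∃ q, q = x3^2 := ⟨_, rfl⟩
    obtain ⟨P1, hp1⟩ : ∃ q, q = x2*x3 := ⟨_, rfl⟩
    obtain ⟨P2, hp2⟩ : ∃ q, q = x1*x3 := ⟨_, rfl⟩
    obtain ⟨P3, hp3⟩ : ∃ q, q = x1*x2 := ⟨_, rfl⟩
    obtain ⟨A, hAdef⟩ : ∃ A, A = a1*a2+a1*a3+a2*a3 := ⟨_, rfl⟩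
    have hf : (a1^2*a2*a3*(2*A + a2*a3) - A^3)*q1^2 + (a1*a2^2*a3*(2*A + a1*a3) - A^3)*q2^2
        + (a1*a2*a3^2*(2*A + a1*a2) - A^3)*q3^2
        - 2*a1^2*(A + a2*a3)*(a2*P3 + a3*P2)*q1
        - 2*a2^2*(A + a1*a3)*(a1*P3 + a3*P1)*q2
        - 2*a3^2*(A + a1*a2)*(a2*P1 + a1*P2)*q3
        + (a1*a2*(2*(3*a1*a2 + a2^2 + a1^2)*a3^2 + 2*(a1 + a2)*a1*a2*a3) + 2*A^3)*q1*q2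
        + (a1*a3*(2*(3*a1*a3 + a3^2 + a1^2)*a2^2 + 2*(a1 + a3)*a1*a2*a3) + 2*A^3)*q1*q3
        + (a2*a3*(2*(3*a2*a3 + a3^2 + a2^2)*a1^2 + 2*(a2 + a3)*a1*a2*a3) + 2*A^3)*q2*q3
        + (a1*a2*P3+a1*a3*P2+a2*a3*P1)^2
        - 2*a1*a2*a3*((A + a2*a3)*q1*P1 + (A + a1*a3)*q2*P2 + (A + a1*a2)*q3*P3) = 0 := by
      rw [← hF2, ← hAdef, hq1, hq2, hq3, hp1, hp2, hp3]; ring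
    have g1 : h1 = a2*P2+a3*P3-(a2+a3)^2*(q1+q2+q3)+4*a2*a3*q1 := by
      rw [hh1, hq1, hq2, hq3, hp2, hp3]; ring
    have g2 : h2 = a1*P1+a3*P3-(a1+a3)^2*(q1+q2+q3)+4*a1*a3*q2 := by
      rw [hh2, hq1, hq2, hq3, hp1, hp3]; ring
    have g3 : h3 = a1*P1+a2*P2-(a1+a2)^2*(q1+q2+q3)+4*a1*a2*q3 := by
      rw [hh3, hq1, hq2, hq3, hp1, hp2]; ring
    rw [← hp1, ← hq1, ← hq2, ← hq3] at hP1
    rw [← hp2, ← hq1, ← hq2, ← hq3] at hP2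
    rw [← hp3, ← hq1, ← hq2, ← hq3] at hP3
    have hmul : A*(2*h1*h2+2*h1*h3+2*h2*h3-h1^2-h2^2-h3^2) = 0 := by
      rw [g1, g2, g3]
      rw [hP1, hP2, hP3, hAdef] at *
      linear_combination 4*hf
    rw [hAdef] at hmul
    exact (mul_eq_zero.mp hmul).resolve_left hA
  -- the form is nilpotent and symmetric, hence zero
  have hsum : ((a1+a3)*h1-(a2+a3)*h2)^2 + (a1*a2+a1*a3+a2*a3)*(h1+h2-h3)^2 = 0 := by
    linear_combination ((a1+a3)*h1+(a2+a3)*h2+a3*(h1+h2-h3))*htr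
      - ((a1+a3)*(a2+a3))*hdet
  have hApos : 0 < a1*a2+a1*a3+a2*a3 := by positivity
  have hm0 : h1+h2-h3 = 0 := by
    have t1 := sq_nonneg ((a1+a3)*h1-(a2+a3)*h2)
    have t2 : 0 ≤ (a1*a2+a1*a3+a2*a3)*(h1+h2-h3)^2 := by positivity
    have t3 : (a1*a2+a1*a3+a2*a3)*(h1+h2-h3)^2 = 0 := by linarith
    exact pow_eq_zero_iff (two_ne_zero) |>.mp ((mul_eq_zero.mp t3).resolve_left hA)
  have hl0 : (a1+a3)*h1-(a2+a3)*h2 = 0 := by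
    rw [hm0] at hsum
    have : ((a1+a3)*h1-(a2+a3)*h2)^2 = 0 := by linarith
    exact pow_eq_zero_iff (two_ne_zero) |>.mp this
  have hh3' : h3 = h1 + h2 := by linarith
  have z1 : h1 = 0 := by
    have t : (a1+a3)*h1 = 0 := by rw [hh3'] at htr; linarith
    exact (mul_eq_zero.mp t).resolve_left (by positivity)
  have z2 : h2 = 0 := by
    have t : (a2+a3)*h2 = 0 := by rw [z1] at hl0; linarith
    exact (mul_eq_zero.mp t).resolve_left (by positivity)
  have z3 : h3 = 0 := by linarith
  rw [hh1] at z1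
  rw [hh2] at z2
  rw [hh3] at z3
  refine ⟨⟨?_, ?_⟩, ⟨?_, ?_⟩, ⟨?_, ?_⟩⟩
  · linear_combination hP2 - hP3
  · linear_combination -z1
  · linear_combination hP1 - hP3
  · linear_combination -z2
  · linear_combination hP1 - hP2
  · linear_combination -z3

theorem rho_delta_zero_iff_quarter (a1 a2 a3 : ℝ)
    (ha1 : a1 ∈ Ioc (0:ℝ) (1/2)) (ha2 : a2 ∈ Ioc (0:ℝ) (1/2)) (ha3 : a3 ∈ Ioc (0:ℝ) (1/2)) :
    (∃ x1 x2 x3 : ℝ, 0 < x1 ∧ 0 < x2 ∧ 0 < x3 ∧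
        eqS1 a1 a2 a3 x1 x2 x3 ∧ eqS2 a1 a2 a3 x1 x2 x3 ∧
        F1 a1 a2 a3 x1 x2 x3 = 0 ∧ F2 a1 a2 a3 x1 x2 x3 = 0) ↔
      (a1 = 1/4 ∧ a2 = 1/4 ∧ a3 = 1/4) := by
  constructor
  · rintro ⟨x1, x2, x3, hx1, hx2, hx3, hS1, hS2, hF1, hF2⟩
    have b1 := ha1.1
    have b2 := ha2.1
    have b3 := ha3.1
    obtain ⟨H1, H2, H3⟩ := pairs_of_sys a1 a2 a3 x1 x2 x3 b1 b2 b3 hS1 hS2 hF1 hF2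
    rcases le_total x1 x2 with h12 | h12 <;> rcases le_total x2 x3 with h23 | h23 <;>
      rcases le_total x1 x3 with h13 | h13
    · exact ordered_case a1 a2 a3 x1 x2 x3 b1 b2 b3 hx1 hx2 hx3 h12 h23 H1 H2 H3
    · exact ordered_case a1 a2 a3 x1 x2 x3 b1 b2 b3 hx1 hx2 hx3 h12 h23 H1 H2 H3
    · have := ordered_case a1 a3 a2 x1 x3 x2 b1 b3 b2 hx1 hx3 hx2 h13 h23 H1.swap H3 H2
      tauto
    · have := ordered_case a3 a1 a2 x3 x1 x2 b3 b1 b2 hx3 hx1 hx2 h13 h12 H3 H1.swap H2.swap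
      tauto
    · have := ordered_case a2 a1 a3 x2 x1 x3 b2 b1 b3 hx2 hx1 hx3 h12 h13 H2 H1 H3.swap
      tauto
    · have := ordered_case a2 a3 a1 x2 x3 x1 b2 b3 b1 hx2 hx3 hx1 h23 h13 H2.swap H3.swap H1
      tauto
    · have := ordered_case a3 a2 a1 x3 x2 x1 b3 b2 b1 hx3 hx2 hx1 h23 h12 H3.swap H2.swap H1.swap
      tauto
    · have := ordered_case a3 a2 a1 x3 x2 x1 b3 b2 b1 hx3 hx2 hx1 h23 h12 H3.swap H2.swap H1.swap
      tauto
  · rintro ⟨rfl, rfl, rfl⟩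
    refine ⟨1, 1, 1, one_pos, one_pos, one_pos, ?_, ?_, ?_, ?_⟩ <;>
      norm_num [eqS1, eqS2, F1, F2, AA]
end
end

section
/- Let U = {(a1,a2,a3) ∈ (0,1/2)×(0,1/2)×(0,1/2) : Q(a1,a2,a3) ≠ 0} and let O1 be the connected component of U containing the point (1/6, 1/6, 1/6). Then for every (a1,a2,a3) ∈ O1, the set of pairs (x1,x2) of positive reals such that (x1, x2, 1) satisfies system (S) has exactly four elements; exactly one of these four pairs satisfies F2(x1,x2,1) > 0 (a node of the reduced planar Ricci flow system) and the other three satisfy F2(x1,x2,1) < 0 (saddles). -/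
noncomputable section
open Real Set

/-- The parameter set `U` of non-degenerate parameter triples in the open cube. -/
def Uset : Set (ℝ × ℝ × ℝ) :=
  {p | p.1 ∈ Ioo (0:ℝ) (1/2) ∧ p.2.1 ∈ Ioo (0:ℝ) (1/2) ∧ p.2.2 ∈ Ioo (0:ℝ) (1/2) ∧
    Qpoly p.1 p.2.1 p.2.2 ≠ 0}


/-- `G1 - G3` at `x3 = 1`. -/
def E1 (a1 a2 a3 x y : ℝ) : ℝ := y + a1*(x^2-y^2-1) - (x*y + a3*(1-x^2-y^2))

/-- `G2 - G3` at `x3 = 1`. -/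
def E2 (a1 a2 a3 x y : ℝ) : ℝ := x + a2*(y^2-x^2-1) - (x*y + a3*(1-x^2-y^2))

/-- Jacobian determinant of `(E1, E2)` in `(x, y)`. -/
def Jac (a1 a2 a3 x y : ℝ) : ℝ :=
  (2*a1*x - y + 2*a3*x)*(2*a2*y - x + 2*a3*y) - (1-2*a1*y-x+2*a3*y)*(1-2*a2*x-y+2*a3*x)

lemma S_iff (a1 a2 a3 x y : ℝ) (hA : 0 < a1*a2 + a1*a3 + a2*a3) :
    (eqS1 a1 a2 a3 x y 1 ∧ eqS2 a1 a2 a3 x y 1) ↔ (E1 a1 a2 a3 x y = 0 ∧ E2 a1 a2 a3 x y = 0) := by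
  unfold eqS1 eqS2 E1 E2
  constructor
  · rintro ⟨h1, h2⟩
    constructor
    · apply (mul_eq_zero.mp _).resolve_left hA.ne'
      linear_combination (-(a1+a3)) * h1 - a3 * h2
    · apply (mul_eq_zero.mp _).resolve_left hA.ne'
      linear_combination (-(a2+a3)) * h2 - a3 * h1
  · rintro ⟨h1, h2⟩
    constructor
    · linear_combination (-(a2+a3)) * h1 + a3 * h2
    · linear_combination (-(a1+a3)) * h2 + a3 * h1

lemma F2_eq (a1 a2 a3 x y : ℝ) (h1 : E1 a1 a2 a3 x y = 0) (h2 : E2 a1 a2 a3 x y = 0) :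
    F2 a1 a2 a3 x y 1 = (a1*a2 + a1*a3 + a2*a3)^2 * (x * y) * Jac a1 a2 a3 x y := by
  unfold E1 at h1
  unfold E2 at h2
  simp only [F2, Jac]
  linear_combination ((-1)*a3^4*x + (1)*a3^4*x*y + (1)*a3^5 + (-1)*a3^5*y^2 + (-1)*a3^5*x^2 + (1)*a2*a3^3*x + (-1)*a2*a3^3*x*y + (2)*a2*a3^4*x^2 + (1)*a2^2*a3^2*y + (1)*a2^2*a3^2*x*y + (-1)*a2^2*a3^3 + (-1)*a2^2*a3^3*y^2 + (-1)*a2^2*a3^3*x^2 + (1)*a2^3*a3^2 + (-3)*a2^3*a3^2*y^2 + (-1)*a2^3*a3^2*x^2 + (1)*a1*a3^3*x + (-1)*a1*a3^3*x*y + (-1)*a1*a3^4 + (1)*a1*a3^4*y^2 + (1)*a1*a3^4*x^2 + (-1)*a1*a2*a3^2*x + (3)*a1*a2*a3^2*x*y + (2)*a1*a2*a3^3 + (-4)*a1*a2*a3^3*y^2 + (-2)*a1*a2*a3^3*x^2 + (2)*a1*a2^2*a3*x*y + (4)*a1*a2^2*a3^2 + (-10)*a1*a2^2*a3^2*y^2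 + (-2)*a1*a2^2*a3^2*x^2 + (2)*a1*a2^3*a3 + (-4)*a1*a2^3*a3*y^2 + (-2)*a1*a2^3*a3*x^2 + (-2)*a1^2*a3^2*x + (2)*a1^2*a3^2*x*y + (3)*a1^2*a3^3 + (-3)*a1^2*a3^3*y^2 + (-1)*a1^2*a3^3*x^2 + (-2)*a1^2*a2*a3*x + (2)*a1^2*a2*a3*x*y + (7)*a1^2*a2*a3^2 + (-7)*a1^2*a2*a3^2*y^2 + (-1)*a1^2*a2*a3^2*x^2 + (5)*a1^2*a2^2*a3 + (-5)*a1^2*a2^2*a3*y^2 + (-1)*a1^2*a2^2*a3*x^2 + (1)*a1^2*a2^3 + (-1)*a1^2*a2^3*y^2 + (-1)*a1^2*a2^3*x^2) * h1 + ((1)*a3^4*y + (-1)*a3^4*x*y + (-1)*a3^5 + (1)*a3^5*y^2 + (1)*a3^5*x^2 + (-1)*a2*a3^3*y + (1)*a2*a3^3*x*y + (1)*a2*a3^4 + (-1)*a2*a3^4*y^2 + (-1)*a2*a3^4*x^2 + (1)*a2^2*a3^2*y + (-1)*a2^2*a3^2*x*y + (2)*a2^2*a3^3*y^2 + (-1)*a1*a3^3*y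 + (1)*a1*a3^3*x*y + (-2)*a1*a3^4*y^2 + (5)*a1*a2*a3^2*y + (-3)*a1*a2*a3^2*x*y + (-2)*a1*a2*a3^3 + (6)*a1*a2*a3^3*y^2 + (2)*a1*a2^2*a3*y + (-2)*a1*a2^2*a3*x*y + (3)*a1^2*a3^2*y + (1)*a1^2*a3^2*x + (-2)*a1^2*a3^2*x*y + (-2)*a1^2*a3^3 + (4)*a1^2*a3^3*y^2 + (4)*a1^2*a2*a3*y + (-2)*a1^2*a2*a3*x*y + (-6)*a1^2*a2*a3^2 + (-4)*a1^2*a2*a3^2*y^2 + (1)*a1^2*a2^2*y + (-1)*a1^2*a2^2*x*y + (-4)*a1^2*a2^2*a3*y^2 + (-2)*a1^3*a3^2 + (-4)*a1^3*a3^2*y^2 + (-2)*a1^3*a2*a3 + (-6)*a1^3*a2*a3*y^2 + (-2)*a1^3*a2^2*y^2) * h2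

lemma resultant_zero (A B C D E F s t : ℝ) (hst : s ≠ 0 ∨ t ≠ 0)
    (h1 : A*s^2 + B*s*t + C*t^2 = 0) (h2 : D*s^2 + E*s*t + F*t^2 = 0) :
    (A*F - C*D)^2 - (A*E - B*D)*(B*F - C*E) = 0 := by
  -- cross products of the coefficient rows are proportional to (s^2, s t, t^2)
  have c1 : (A*E - B*D)*s*t + (A*F - C*D)*t^2 = 0 := by
    linear_combination A * h2 - D * h1
  have c2 : (A*E - B*D)*s^2 - (B*F - C*E)*t^2 = 0 := by
    linear_combination E * h1 - B * h2
  have c3 : (A*F - C*D)*s^2 + (B*F - C*E)*s*t = 0 := by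
    linear_combination F * h1 - C * h2
  rcases hst with hs | ht
  · have : s * ((A*F - C*D)*s + (B*F - C*E)*t) = 0 := by linear_combination c3
    have e1 := (mul_eq_zero.mp this).resolve_left hs
    have : s^2 * ((A*F - C*D)^2 - (A*E - B*D)*(B*F - C*E)) = 0 := by
      linear_combination ((A*F - C*D)*s - (B*F - C*E)*t)*e1 - (B*F-C*E)*c2
    exact (mul_eq_zero.mp this).resolve_left (pow_ne_zero _ hs)
  · have : t * ((A*E - B*D)*s + (A*F - C*D)*t) = 0 := by linear_combination c1
    have e1 := (mul_eq_zero.mp this).resolve_left ht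
    have : t^2 * ((A*F - C*D)^2 - (A*E - B*D)*(B*F - C*E)) = 0 := by
      linear_combination ((A*F - C*D)*t - (A*E - B*D)*s)*e1 + (A*E-B*D)*c2
    exact (mul_eq_zero.mp this).resolve_left (pow_ne_zero _ ht)

/-- Adjugate pairing for a symmetric matrix killing `(x, y, 1)`. -/
lemma adj_pair (m11 m12 m13 m22 m23 m33 n11 n12 n13 n22 n23 n33 x y : ℝ)
    (h1 : m11*x + m12*y + m13 = 0) (h2 : m12*x + m22*y + m23 = 0)
    (h3 : m13*x + m23*y + m33 = 0)
    (hn : n11*x^2 + n22*y^2 + n33 + 2*n12*x*y + 2*n13*x + 2*n23*y = 0) :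
    (m22*m33 - m23^2)*n11 + (m11*m33 - m13^2)*n22 + (m11*m22 - m12^2)*n33
      + 2*(m13*m23 - m12*m33)*n12 + 2*(m12*m23 - m13*m22)*n13 + 2*(m12*m13 - m11*m23)*n23 = 0 := by
  have e1 : m13 = -(m11*x + m12*y) := by linarith
  have e2 : m23 = -(m12*x + m22*y) := by linarith
  have e3 : m33 = m11*x^2 + 2*m12*x*y + m22*y^2 := by rw [e1, e2] at h3; linarith
  rw [e1, e2, e3]
  linear_combination (m11*m22 - m12^2) * hn

/-- Coefficients of `det (s H1 + t H2)`. -/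
def c0 (a1 a2 a3 : ℝ) : ℝ := -(2*a1+2*a3)*(2*a3-2*a1)*(2*a1+2*a3) - (2*a1+2*a3) + (2*a1+2*a3)

def c1 (a1 a2 a3 : ℝ) : ℝ :=
  ((2*a3-2*a1)*(-2*a1-2*a3) - 1)*(2*a3-2*a2) + (2*a1+2*a3)*(-2*a1-2*a3)*(2*a2+2*a3)
    + ((2*a1+2*a3)*(2*a3-2*a1) - 1)*(-2*a2-2*a3) + 2*(-2*a1-2*a3)*(-1) + 2*(-1)*1

def c2 (a1 a2 a3 : ℝ) : ℝ :=
  ((2*a2+2*a3)*(-2*a2-2*a3))*(2*a1+2*a3) + ((2*a3-2*a2)*(-2*a2-2*a3) - 1)*(2*a3-2*a1)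
    + ((2*a3-2*a2)*(2*a2+2*a3) - 1)*(-2*a1-2*a3) + 2*(-2*a2-2*a3)*(-1) + 2*(-1)*1

def c3 (a1 a2 a3 : ℝ) : ℝ :=
  (2*a3-2*a2)*(2*a2+2*a3)*(-2*a2-2*a3) - (2*a2+2*a3) - (-2*a2-2*a3)

lemma disc_eq (a1 a2 a3 : ℝ) :
    (9 * c0 a1 a2 a3 * c3 a1 a2 a3 - c2 a1 a2 a3 * c1 a1 a2 a3)^2
      - (6 * c0 a1 a2 a3 * c2 a1 a2 a3 - 2 * c1 a1 a2 a3 ^2)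
        * (6 * c1 a1 a2 a3 * c3 a1 a2 a3 - 2 * c2 a1 a2 a3 ^2) = 48 * Qpoly a1 a2 a3 := by
  simp only [Qpoly, c0, c1, c2, c3]
  ring

lemma exists_comb (u1 u2 w1 w2 : ℝ) (h : u1*w2 - u2*w1 = 0) :
    ∃ s t : ℝ, (s ≠ 0 ∨ t ≠ 0) ∧ s*u1 + t*w1 = 0 ∧ s*u2 + t*w2 = 0 := by
  by_cases h1 : w1 ≠ 0 ∨ u1 ≠ 0
  · refine ⟨w1, -u1, ?_, by ring, by linarith⟩
    simpa using h1
  · push Not at h1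
    by_cases h2 : w2 ≠ 0 ∨ u2 ≠ 0
    · refine ⟨w2, -u2, ?_, by linarith, by ring⟩
      simpa using h2
    · push Not at h2
      exact ⟨1, 0, Or.inl one_ne_zero, by simp [h1.2], by simp [h2.2]⟩

lemma degenerate (a1 a2 a3 x y : ℝ) (h1 : E1 a1 a2 a3 x y = 0) (h2 : E2 a1 a2 a3 x y = 0)
    (hJ : Jac a1 a2 a3 x y = 0) : Qpoly a1 a2 a3 = 0 := by
  obtain ⟨s, t, hst, k1, k2⟩ := exists_comb _ _ _ _ hJ
  unfold E1 at h1
  unfold E2 at h2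
  have m1 : (s*(2*a1+2*a3) + t*(2*a3-2*a2))*x + (-s-t)*y + t = 0 := by linear_combination k1
  have m2 : (-s-t)*x + (s*(2*a3-2*a1) + t*(2*a2+2*a3))*y + s = 0 := by linear_combination k2
  have m3 : t*x + s*y + (s*(-2*a1-2*a3) + t*(-2*a2-2*a3)) = 0 := by
    linear_combination 2*s*h1 + 2*t*h2 - x * m1 - y * m2
  have q1 := adj_pair _ _ _ _ _ _ (2*a1+2*a3) (-1) 0 (2*a3-2*a1) 1 (-2*a1-2*a3) x y m1 m2 m3
    (by linear_combination 2*h1)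
  have q2 := adj_pair _ _ _ _ _ _ (2*a3-2*a2) (-1) 1 (2*a2+2*a3) 0 (-2*a2-2*a3) x y m1 m2 m3
    (by linear_combination 2*h2)
  have r := resultant_zero (3 * c0 a1 a2 a3) (2 * c1 a1 a2 a3) (c2 a1 a2 a3) (c1 a1 a2 a3)
    (2 * c2 a1 a2 a3) (3 * c3 a1 a2 a3) s t hst
    (by simp only [c0, c1, c2]; linear_combination q1)
    (by simp only [c1, c2, c3]; linear_combination q2)
  have := disc_eq a1 a2 a3
  nlinarith

/-- Local constancy of the fibre cardinality for a proper, locally uniquely solvable relation. -/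
lemma ncard_locally {P Y : Type*} [TopologicalSpace P] [T2Space P] [TopologicalSpace Y] [T2Space Y]
    (Z : Set (P × Y)) (p0 : P) (K : Set P) (hK : K ∈ nhds p0)
    (hc : IsCompact {z | z ∈ Z ∧ z.1 ∈ K})
    (hloc : ∀ y0, (p0, y0) ∈ Z → ∀ V0 ∈ nhds y0, ∃ V ∈ nhds y0, V ⊆ V0 ∧
      ∀ᶠ p in nhds p0, ∃! y, y ∈ V ∧ (p, y) ∈ Z) :
    ∀ᶠ p in nhds p0, {y | (p, y) ∈ Z}.ncard = {y | (p0, y) ∈ Z}.ncard := by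
  set F0 : Set Y := {y | (p0, y) ∈ Z} with hF0
  have hF0c : IsCompact F0 := by
    have h1 : IsCompact ({z | z ∈ Z ∧ z.1 ∈ K} ∩ (Prod.fst ⁻¹' {p0})) :=
      hc.inter_right (isClosed_singleton.preimage continuous_fst)
    have h2 := h1.image continuous_snd
    convert h2 using 1
    ext y
    constructor
    · intro hy
      exact ⟨(p0, y), ⟨⟨hy, mem_of_mem_nhds hK⟩, rfl⟩, rfl⟩
    · rintro ⟨⟨p, y'⟩, ⟨⟨h, _⟩, h3⟩, rfl⟩
      simp only [mem_preimage, mem_singleton_iff] at h3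
      subst h3
      exact h
  have hfin : F0.Finite := by
    have : ∀ y ∈ F0, ∃ V ∈ nhds y, (V ∩ F0).Subsingleton := by
      intro y hy
      obtain ⟨V, hV, -, he⟩ := hloc y hy univ Filter.univ_mem
      refine ⟨V, hV, ?_⟩
      obtain ⟨w, -, hw⟩ := he.self_of_nhds
      intro a ha b hb
      rw [hw a ⟨ha.1, ha.2⟩, hw b ⟨hb.1, hb.2⟩]
    choose! V hV hs using this
    obtain ⟨t, ht, hcov⟩ := hF0c.elim_nhds_subcover V hV
    have : F0 ⊆ ⋃ y ∈ t, (V y ∩ F0) := by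
      intro y hy
      have := hcov hy
      simp only [mem_iUnion] at this ⊢
      obtain ⟨i, hi, h⟩ := this
      exact ⟨i, hi, h, hy⟩
    refine Set.Finite.subset (Set.Finite.biUnion t.finite_toSet ?_) this
    intro y hy
    exact (hs y (ht y hy)).finite
  obtain ⟨U, hU, hdis⟩ := hfin.t2_separation
  have : ∀ y ∈ F0, ∃ V ∈ nhds y, V ⊆ U y ∧ ∀ᶠ p in nhds p0, ∃! w, w ∈ V ∧ (p, w) ∈ Z :=
    fun y hy => hloc y hy _ ((hU y).2.mem_nhds (hU y).1)
  choose! V hV hVU hVe using this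
  have hev : ∀ᶠ p in nhds p0, ∀ y ∈ F0, ∃! w, w ∈ V y ∧ (p, w) ∈ Z :=
    (Filter.eventually_all_finite hfin).2 hVe
  -- all solutions nearby lie in the union of the neighbourhoods
  set O : Set Y := ⋃ y ∈ F0, interior (V y) with hO
  have hOo : IsOpen O := isOpen_biUnion fun y _ => isOpen_interior
  have hC : IsCompact ({z | z ∈ Z ∧ z.1 ∈ K} ∩ (Prod.snd ⁻¹' Oᶜ)) :=
    hc.inter_right (hOo.isClosed_compl.preimage continuous_snd)
  have hCl := (hC.image continuous_fst).isClosed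
  have hp0 : p0 ∈ (Prod.fst '' ({z | z ∈ Z ∧ z.1 ∈ K} ∩ (Prod.snd ⁻¹' Oᶜ)))ᶜ := by
    rintro ⟨⟨p, y⟩, ⟨⟨h, _⟩, h3⟩, h4⟩
    simp only at h4
    subst h4
    apply h3
    simp only [hO, mem_iUnion]
    exact ⟨y, h, mem_interior_iff_mem_nhds.2 (hV y h)⟩
  filter_upwards [hev, hK, hCl.isOpen_compl.mem_nhds hp0] with p hp hpK hpc
  have hcover : ∀ w, (p, w) ∈ Z → ∃ y ∈ F0, w ∈ V y := by
    intro w hw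
    by_contra hcon
    push Not at hcon
    apply hpc
    refine ⟨(p, w), ⟨⟨hw, hpK⟩, ?_⟩, rfl⟩
    intro hwO
    simp only [hO, mem_iUnion] at hwO
    obtain ⟨y, hy, h⟩ := hwO
    exact hcon y hy (interior_subset h)
  symm
  refine Set.ncard_congr (fun y hy => (hp y hy).choose) ?_ ?_ ?_
  · intro y hy
    exact (hp y hy).choose_spec.1.2
  · intro y z hy hz h
    have h1 := (hp y hy).choose_spec.1.1
    have h2 := (hp z hz).choose_spec.1.1
    simp only at h
    rw [← h] at h2
    by_contra hne
    exact Set.disjoint_left.1 (hdis hy hz hne) (hVU y hy h1) (hVU z hz h2)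
  · intro w hw
    obtain ⟨y, hy, hwy⟩ := hcover w hw
    exact ⟨y, hy, ((hp y hy).choose_spec.2 w ⟨hwy, hw⟩).symm⟩

/-- The solution set with Jacobian in `T`. -/
def Zset (T : Set ℝ) : Set ((ℝ × ℝ × ℝ) × (ℝ × ℝ)) :=
  {z | 0 < z.2.1 ∧ 0 < z.2.2 ∧ E1 z.1.1 z.1.2.1 z.1.2.2 z.2.1 z.2.2 = 0 ∧
    E2 z.1.1 z.1.2.1 z.1.2.2 z.2.1 z.2.2 = 0 ∧ Jac z.1.1 z.1.2.1 z.1.2.2 z.2.1 z.2.2 ∈ T}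

lemma continuous_Jac :
    Continuous fun z : (ℝ × ℝ × ℝ) × (ℝ × ℝ) => Jac z.1.1 z.1.2.1 z.1.2.2 z.2.1 z.2.2 := by
  unfold Jac; fun_prop

lemma isOpen_Uset : IsOpen Uset := by
  have hQ : Continuous fun p : ℝ × ℝ × ℝ => Qpoly p.1 p.2.1 p.2.2 := by
    unfold Qpoly; fun_prop
  have h1 : IsOpen {p : ℝ × ℝ × ℝ | p.1 ∈ Ioo (0:ℝ) (1/2)} := isOpen_Ioo.preimage continuous_fst
  have h2 : IsOpen {p : ℝ × ℝ × ℝ | p.2.1 ∈ Ioo (0:ℝ) (1/2)} :=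
    isOpen_Ioo.preimage (continuous_fst.comp continuous_snd)
  have h3 : IsOpen {p : ℝ × ℝ × ℝ | p.2.2 ∈ Ioo (0:ℝ) (1/2)} :=
    isOpen_Ioo.preimage (continuous_snd.comp continuous_snd)
  have h4 : IsOpen {p : ℝ × ℝ × ℝ | Qpoly p.1 p.2.1 p.2.2 ≠ 0} :=
    isOpen_compl_singleton.preimage hQ
  exact h1.inter (h2.inter (h3.inter h4))

lemma bdry (a b c x y : ℝ) (ha : 0 < a) (hb : 0 < b) (hc : c < 1/2) (hx : 0 ≤ x) (hy : 0 ≤ y)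
    (h1 : a*(x^2-y^2) = b*(y^2-x^2)) (h2 : x*y - c*(x^2+y^2) = a*(x^2-y^2)) : x + y = 0 := by
  have h3 : (a+b)*(x^2-y^2) = 0 := by linear_combination h1
  have h4 : x^2 - y^2 = 0 := (mul_eq_zero.mp h3).resolve_left (by positivity)
  have h5 : x = y := by
    rcases mul_eq_zero.mp (show (x-y)*(x+y) = 0 by linear_combination h4) with h | h
    · linarith
    · linarith
  subst h5
  have h6 : (1-2*c)*x^2 = 0 := by linear_combination h2
  have h7 : x^2 = 0 := (mul_eq_zero.mp h6).resolve_left (by linarith)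
  have h8 : x = 0 := by simpa using h7
  simp [h8]

lemma compact_Z (K : Set (ℝ × ℝ × ℝ)) (hK : IsCompact K) (hKU : K ⊆ Uset) :
    IsCompact {z | z ∈ Zset univ ∧ z.1 ∈ K} := by
  let B : Set ((ℝ × ℝ × ℝ) × (ℝ × ℝ × ℝ)) := (K ×ˢ (Icc (0:ℝ) 1 ×ˢ (Icc (0:ℝ) 1 ×ˢ Icc (0:ℝ) 1)))
    ∩ {z | z.2.1 + z.2.2.1 + z.2.2.2 = 1 ∧
      z.2.2.1*z.2.2.2 + z.1.1*(z.2.1^2-z.2.2.1^2-z.2.2.2^2)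
        = z.2.1*z.2.2.1 + z.1.2.2*(z.2.2.2^2-z.2.1^2-z.2.2.1^2) ∧
      z.2.1*z.2.2.2 + z.1.2.1*(z.2.2.1^2-z.2.1^2-z.2.2.2^2)
        = z.2.1*z.2.2.1 + z.1.2.2*(z.2.2.2^2-z.2.1^2-z.2.2.1^2)}
  have hB : IsCompact B := by
    apply IsCompact.inter_right
    · exact hK.prod (isCompact_Icc.prod (isCompact_Icc.prod isCompact_Icc))
    · refine (isClosed_eq (by fun_prop) (by fun_prop)).inter
        ((isClosed_eq (by fun_prop) (by fun_prop)).inter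
          (isClosed_eq (by fun_prop) (by fun_prop)))
  have hpos : ∀ z ∈ B, 0 < z.2.1 ∧ 0 < z.2.2.1 ∧ 0 < z.2.2.2 := by
    rintro ⟨⟨a1, a2, a3⟩, ⟨x, y, w⟩⟩ ⟨⟨hk, ⟨hx, -⟩, ⟨hy, -⟩, ⟨hw, -⟩⟩, hs, e1, e2⟩
    obtain ⟨⟨u1, v1⟩, ⟨u2, v2⟩, ⟨u3, v3⟩, -⟩ := hKU hk
    simp only at *
    refine ⟨lt_of_le_of_ne hx ?_, lt_of_le_of_ne hy ?_, lt_of_le_of_ne hw ?_⟩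
    · rintro rfl
      have := bdry a2 a3 a1 y w u2 u3 v1 hy hw (by linear_combination e2)
        (by linear_combination e1 - e2)
      linarith
    · rintro rfl
      have := bdry a1 a3 a2 x w u1 u3 v2 hx hw (by linear_combination e1)
        (by linear_combination e2 - e1)
      linarith
    · rintro rfl
      have := bdry a1 a2 a3 x y u1 u2 v3 hx hy (by linear_combination e1 - e2)
        (by linear_combination -e1)
      linarith
  have himg : IsCompact ((fun z : (ℝ × ℝ × ℝ) × (ℝ × ℝ × ℝ) =>
      (z.1, (z.2.1 / z.2.2.2, z.2.2.1 / z.2.2.2))) '' B) := by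
    apply hB.image_of_continuousOn
    have hne : ∀ z ∈ B, z.2.2.2 ≠ 0 := fun z hz => (hpos z hz).2.2.ne'
    refine ContinuousOn.prodMk (by fun_prop) (ContinuousOn.prodMk ?_ ?_)
    · exact ContinuousOn.div (by fun_prop) (by fun_prop) hne
    · exact ContinuousOn.div (by fun_prop) (by fun_prop) hne
  convert himg using 1
  ext ⟨⟨a1, a2, a3⟩, ⟨x, y⟩⟩
  constructor
  · rintro ⟨⟨hx, hy, e1, e2, -⟩, hk⟩
    simp only [E1, E2] at hx hy e1 e2 hk
    have hd : 0 < x + y + 1 := by linarith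
    refine ⟨((a1, a2, a3), (x/(x+y+1), y/(x+y+1), 1/(x+y+1))), ⟨⟨hk, ?_, ?_, ?_⟩, ?_, ?_, ?_⟩, ?_⟩
    · exact ⟨by positivity, by rw [div_le_one hd]; linarith⟩
    · exact ⟨by positivity, by rw [div_le_one hd]; linarith⟩
    · exact ⟨by positivity, by rw [div_le_one hd]; linarith⟩
    · simp only; field_simp
    · simp only; field_simp; linear_combination e1
    · simp only; field_simp; linear_combination e2
    · simp only [Prod.mk.injEq, true_and]
      constructor <;> field_simp
  · rintro ⟨⟨⟨b1, b2, b3⟩, ⟨x1, x2, x3⟩⟩, hz, heq⟩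
    obtain ⟨p1, p2, p3⟩ := hpos _ hz
    obtain ⟨⟨hk, -⟩, -, e1, e2⟩ := hz
    simp only [Prod.mk.injEq] at heq p1 p2 p3 hk e1 e2
    obtain ⟨⟨rfl, rfl, rfl⟩, rfl, rfl⟩ := heq
    refine ⟨⟨?_, ?_, ?_, ?_, mem_univ _⟩, hk⟩
    · simp only; positivity
    · simp only; positivity
    · simp only [E1]; field_simp; linear_combination e1
    · simp only [E2]; field_simp; linear_combination e2

lemma compact_ZT (T T' : Set ℝ) (hT' : IsClosed T') (h1 : T ⊆ T') (h2 : ∀ t ∈ T', t ≠ 0 → t ∈ T)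
    (K : Set (ℝ × ℝ × ℝ)) (hK : IsCompact K) (hKU : K ⊆ Uset) :
    IsCompact {z | z ∈ Zset T ∧ z.1 ∈ K} := by
  have := (compact_Z K hK hKU).inter_right (hT'.preimage continuous_Jac)
  convert this using 1
  ext z
  constructor
  · rintro ⟨⟨hx, hy, e1, e2, hj⟩, hk⟩
    exact ⟨⟨⟨hx, hy, e1, e2, mem_univ _⟩, hk⟩, h1 hj⟩
  · rintro ⟨⟨⟨hx, hy, e1, e2, -⟩, hk⟩, hj⟩
    refine ⟨⟨hx, hy, e1, e2, h2 _ hj ?_⟩, hk⟩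
    intro h0
    exact (hKU hk).2.2.2 (degenerate _ _ _ _ _ e1 e2 h0)

/-- The map to which the inverse function theorem is applied. -/
def Phi (z : (ℝ × ℝ × ℝ) × (ℝ × ℝ)) : (ℝ × ℝ × ℝ) × (ℝ × ℝ) :=
  (z.1, (E1 z.1.1 z.1.2.1 z.1.2.2 z.2.1 z.2.2, E2 z.1.1 z.1.2.1 z.1.2.2 z.2.1 z.2.2))

lemma contDiff_Phi : ContDiff ℝ 1 Phi := by
  unfold Phi E1 E2; fun_prop

lemma fderiv_Phi_inj (z : (ℝ × ℝ × ℝ) × (ℝ × ℝ))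
    (hJ : Jac z.1.1 z.1.2.1 z.1.2.2 z.2.1 z.2.2 ≠ 0) :
    Function.Injective (fderiv ℝ Phi z) := by
  rw [injective_iff_map_eq_zero]
  rintro ⟨dp, ⟨dx, dy⟩⟩ hv
  have hd : HasFDerivAt Phi (fderiv ℝ Phi z) z :=
    (contDiff_Phi.differentiable (by norm_num) z).hasFDerivAt
  -- parameters
  have hp : dp = 0 := by
    have h1 : HasFDerivAt (fun w => (Phi w).1) (ContinuousLinearMap.fst ℝ _ _) z := hasFDerivAt_fst
    have h2 := hd.fst
    have h3 := h1.unique h2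
    have := congrArg (fun L => L (dp, (dx, dy))) h3
    simpa [hv] using this
  subst hp
  obtain ⟨⟨a1, a2, a3⟩, ⟨x, y⟩⟩ := z
  have hline : HasDerivAt (fun t : ℝ => (((a1, a2, a3), (x + t*dx, y + t*dy)) :
      (ℝ × ℝ × ℝ) × (ℝ × ℝ))) ((0 : ℝ × ℝ × ℝ), (dx, dy)) 0 := by
    refine (hasDerivAt_const _ _).prodMk (HasDerivAt.prodMk ?_ ?_)
    · simpa using ((hasDerivAt_id (0:ℝ)).mul_const dx).const_add x
    · simpa using ((hasDerivAt_id (0:ℝ)).mul_const dy).const_add y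
  have hd' : HasFDerivAt Phi (fderiv ℝ Phi ((a1, a2, a3), (x, y)))
      ((a1, a2, a3), (x + 0*dx, y + 0*dy)) := by simpa using hd
  have hcomp := hd'.comp_hasDerivAt (0:ℝ) hline
  rw [hv] at hcomp
  have hX : HasDerivAt (fun t : ℝ => x + t*dx) dx 0 := by
    simpa using ((hasDerivAt_id (0:ℝ)).mul_const dx).const_add x
  have hY : HasDerivAt (fun t : ℝ => y + t*dy) dy 0 := by
    simpa using ((hasDerivAt_id (0:ℝ)).mul_const dy).const_add y
  have k1 : HasDerivAt (fun t : ℝ => E1 a1 a2 a3 (x + t*dx) (y + t*dy)) 0 0 := hcomp.snd.fst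
  have k2 : HasDerivAt (fun t : ℝ => E2 a1 a2 a3 (x + t*dx) (y + t*dy)) 0 0 := hcomp.snd.snd
  have l1 : HasDerivAt (fun t : ℝ => E1 a1 a2 a3 (x + t*dx) (y + t*dy)) _ 0 :=
    (hY.add ((((hX.pow 2).sub (hY.pow 2)).sub_const 1).const_mul a1)).sub
      ((hX.mul hY).add ((((hX.pow 2).const_sub 1).sub (hY.pow 2)).const_mul a3))
  have l2 : HasDerivAt (fun t : ℝ => E2 a1 a2 a3 (x + t*dx) (y + t*dy)) _ 0 :=
    (hX.add ((((hY.pow 2).sub (hX.pow 2)).sub_const 1).const_mul a2)).sub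
      ((hX.mul hY).add ((((hX.pow 2).const_sub 1).sub (hY.pow 2)).const_mul a3))
  have m1 := k1.unique l1
  have m2 := k2.unique l2
  simp at m1 m2
  have n1 : (2*a1*x - y + 2*a3*x)*dx + (1-2*a1*y-x+2*a3*y)*dy = 0 := by linear_combination -m1
  have n2 : (1-2*a2*x-y+2*a3*x)*dx + (2*a2*y - x + 2*a3*y)*dy = 0 := by linear_combination -m2
  simp only [Jac] at hJ
  have hx0 : dx = 0 := by
    apply (mul_eq_zero.mp _).resolve_left hJ
    linear_combination (2*a2*y - x + 2*a3*y)*n1 - (1-2*a1*y-x+2*a3*y)*n2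
  have hy0 : dy = 0 := by
    apply (mul_eq_zero.mp _).resolve_left hJ
    linear_combination (2*a1*x - y + 2*a3*x)*n2 - (1-2*a2*x-y+2*a3*x)*n1
  simp [hx0, hy0]

lemma local_Z (T : Set ℝ) (hT : IsOpen T) (p0 : ℝ × ℝ × ℝ) (y0 : ℝ × ℝ)
    (hz : (p0, y0) ∈ Zset T) (hJ : Jac p0.1 p0.2.1 p0.2.2 y0.1 y0.2 ≠ 0)
    (V0 : Set (ℝ × ℝ)) (hV0 : V0 ∈ nhds y0) :
    ∃ V ∈ nhds y0, V ⊆ V0 ∧ ∀ᶠ p in nhds p0, ∃! y, y ∈ V ∧ (p, y) ∈ Zset T := by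
  have hinj := fderiv_Phi_inj (p0, y0) hJ
  let L : ((ℝ × ℝ × ℝ) × (ℝ × ℝ)) ≃L[ℝ] ((ℝ × ℝ × ℝ) × (ℝ × ℝ)) :=
    (LinearEquiv.ofInjectiveEndo (fderiv ℝ Phi (p0, y0)).toLinearMap hinj).toContinuousLinearEquiv
  have hL : (L : _ →L[ℝ] _) = fderiv ℝ Phi (p0, y0) := by
    ext v <;> rfl
  have hs : HasStrictFDerivAt Phi (L : _ →L[ℝ] _) (p0, y0) := by
    rw [hL]
    exact contDiff_Phi.contDiffAt.hasStrictFDerivAt (by norm_num)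
  let e := hs.toOpenPartialHomeomorph Phi
  have hee : ∀ z, e z = Phi z := fun z => rfl
  have hsrc : e.source ∈ nhds (p0, y0) :=
    e.open_source.mem_nhds hs.mem_toOpenPartialHomeomorph_source
  -- good open conditions
  have hgood : {z : (ℝ × ℝ × ℝ) × (ℝ × ℝ) | 0 < z.2.1 ∧ 0 < z.2.2 ∧
      Jac z.1.1 z.1.2.1 z.1.2.2 z.2.1 z.2.2 ∈ T} ∈ nhds (p0, y0) := by
    obtain ⟨hx, hy, -, -, hj⟩ := hz
    have o1 : IsOpen {z : (ℝ × ℝ × ℝ) × (ℝ × ℝ) | 0 < z.2.1} :=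
      isOpen_lt continuous_const (by fun_prop)
    have o2 : IsOpen {z : (ℝ × ℝ × ℝ) × (ℝ × ℝ) | 0 < z.2.2} :=
      isOpen_lt continuous_const (by fun_prop)
    exact (o1.inter (o2.inter (hT.preimage continuous_Jac))).mem_nhds ⟨hx, hy, hj⟩
  obtain ⟨W, hW, V1, hV1, hWV⟩ := mem_nhds_prod_iff.1 (Filter.inter_mem hsrc hgood)
  refine ⟨V1 ∩ V0, Filter.inter_mem hV1 hV0, inter_subset_right, ?_⟩
  have hPhi0 : Phi (p0, y0) = (p0, (0, 0)) := by
    obtain ⟨hx, hy, e1, e2, hj⟩ := hz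
    simp only at e1 e2
    simp [Phi, e1, e2]
  have hcont : Filter.Tendsto (fun p : ℝ × ℝ × ℝ => e.symm (p, (0, 0))) (nhds p0)
      (nhds (p0, y0)) := by
    have h1 : ContinuousAt e.symm (p0, (0, 0)) := by
      apply e.continuousAt_symm
      rw [← hPhi0]
      exact hs.image_mem_toOpenPartialHomeomorph_target
    have h2 : e.symm (p0, (0, 0)) = (p0, y0) := by
      rw [← hPhi0]
      exact e.left_inv (mem_of_mem_nhds hsrc)
    have h3 : ContinuousAt (fun p : ℝ × ℝ × ℝ => (p, ((0:ℝ), (0:ℝ)))) p0 := by fun_prop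
    have h4 := ContinuousAt.comp (f := fun p : ℝ × ℝ × ℝ => (p, ((0:ℝ), (0:ℝ)))) h1 h3
    have h5 : Filter.Tendsto (e.symm ∘ fun p : ℝ × ℝ × ℝ => (p, ((0:ℝ), (0:ℝ)))) (nhds p0)
      (nhds (e.symm (p0, (0, 0)))) := h4
    rw [h2] at h5
    exact h5
  have htgt : ∀ᶠ p in nhds p0, (p, ((0:ℝ), (0:ℝ))) ∈ e.target := by
    have h3 : ContinuousAt (fun p : ℝ × ℝ × ℝ => (p, ((0:ℝ), (0:ℝ)))) p0 := by fun_prop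
    apply h3.eventually (e.open_target.mem_nhds _)
    show (p0, ((0:ℝ), (0:ℝ))) ∈ e.target
    rw [← hPhi0]
    exact hs.image_mem_toOpenPartialHomeomorph_target
  have hbox : W ×ˢ (V1 ∩ V0) ∈ nhds (p0, y0) := prod_mem_nhds hW (Filter.inter_mem hV1 hV0)
  filter_upwards [hcont hbox, htgt, hW] with p hp hpt hpW
  have hr : Phi (e.symm (p, (0, 0))) = (p, (0, 0)) := by
    rw [← hee]; exact e.right_inv hpt
  have hp' : e.symm (p, (0, 0)) ∈ W ×ˢ (V1 ∩ V0) := hp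
  have hmem := hWV (show e.symm (p, (0, 0)) ∈ W ×ˢ V1 from ⟨hp'.1, hp'.2.1⟩)
  generalize hgen : e.symm (p, (0, 0)) = q at hr hp' hmem
  obtain ⟨q1, q2⟩ := q
  simp only [Phi, Prod.mk.injEq] at hr
  obtain ⟨rfl, r1, r2⟩ := hr
  refine ⟨q2, ⟨hp'.2, hmem.2.1, hmem.2.2.1, r1, r2, hmem.2.2.2⟩, ?_⟩
  rintro w ⟨hw, hx, hy, e1, e2, hj⟩
  have hmem2 := hWV (show (q1, w) ∈ W ×ˢ V1 from ⟨hpW, hw.1⟩)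
  have := e.injOn hmem2.1 hmem.1 (by
    rw [hee, hee]
    simp only at e1 e2
    simp [Phi, r1, r2, e1, e2])
  exact congrArg Prod.snd this

lemma count_const (T T' : Set ℝ) (hT : IsOpen T) (hT' : IsClosed T') (h1 : T ⊆ T')
    (h2 : ∀ t ∈ T', t ≠ 0 → t ∈ T) (q p : ℝ × ℝ × ℝ) (hp : p ∈ connectedComponentIn Uset q) :
    {y | (p, y) ∈ Zset T}.ncard = {y | (q, y) ∈ Zset T}.ncard := by
  have hq : q ∈ Uset := by
    by_contra h
    rw [connectedComponentIn_eq_empty h] at hp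
    exact hp
  refine IsPreconnected.constant (isPreconnected_connectedComponentIn (x := q) (F := Uset))
    (f := fun p => {y | (p, y) ∈ Zset T}.ncard) ?_ hp (mem_connectedComponentIn hq)
  intro r hr
  have hrU : r ∈ Uset := connectedComponentIn_subset _ _ hr
  obtain ⟨K, hKn, hKU, hKc⟩ := local_compact_nhds (isOpen_Uset.mem_nhds hrU)
  have hev := ncard_locally (Zset T) r K hKn (compact_ZT T T' hT' h1 h2 K hKc hKU) (by
    intro y0 hz V0 hV0
    refine local_Z T hT r y0 hz ?_ V0 hV0
    intro h0
    exact hrU.2.2.2 (degenerate _ _ _ _ _ hz.2.2.1 hz.2.2.2.1 h0))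
  apply ContinuousAt.continuousWithinAt
  exact (continuousAt_const (y := {y | (r, y) ∈ Zset T}.ncard)).congr
    (Filter.EventuallyEq.symm hev)

lemma base_iff (x y : ℝ) :
    (0 < x ∧ 0 < y ∧ E1 (1/6) (1/6) (1/6) x y = 0 ∧ E2 (1/6) (1/6) (1/6) x y = 0) ↔
      ((x = 1 ∧ y = 1) ∨ (x = 1/2 ∧ y = 1/2) ∨ (x = 1 ∧ y = 2) ∨ (x = 2 ∧ y = 1)) := by
  constructor
  · rintro ⟨-, -, h1, h2⟩
    unfold E1 at h1
    unfold E2 at h2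
    have f1 : (x-1)*(x+1-3*y) = 0 := by linear_combination 3*h1
    have f2 : (y-1)*(y+1-3*x) = 0 := by linear_combination 3*h2
    rcases mul_eq_zero.mp f1 with h | h <;> rcases mul_eq_zero.mp f2 with k | k
    · left; constructor <;> linarith
    · right; right; left; constructor <;> linarith
    · right; right; right; constructor <;> linarith
    · right; left; constructor <;> linarith
  · rintro (⟨rfl, rfl⟩ | ⟨rfl, rfl⟩ | ⟨rfl, rfl⟩ | ⟨rfl, rfl⟩) <;> norm_num [E1, E2]

lemma base_Z (T : Set ℝ) : {y | (((1/6 : ℝ), (1/6 : ℝ), (1/6 : ℝ)), y) ∈ Zset T} =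
    {y : ℝ × ℝ | (y = (1, 1) ∨ y = (1/2, 1/2) ∨ y = (1, 2) ∨ y = (2, 1)) ∧
      Jac (1/6) (1/6) (1/6) y.1 y.2 ∈ T} := by
  ext ⟨x, y⟩
  have := base_iff x y
  simp only [Zset, mem_setOf_eq, Prod.mk.injEq]
  rw [← this]
  tauto

lemma base_univ : {y | (((1/6 : ℝ), (1/6 : ℝ), (1/6 : ℝ)), y) ∈ Zset univ}.ncard = 4 := by
  have : {y | (((1/6 : ℝ), (1/6 : ℝ), (1/6 : ℝ)), y) ∈ Zset univ} =
      (({(1, 1), (1/2, 1/2), (1, 2), (2, 1)} : Finset (ℝ × ℝ)) : Set (ℝ × ℝ)) := by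
    rw [base_Z]; ext y; simp
  rw [this, Set.ncard_coe_finset]
  norm_num [Finset.card_insert_of_notMem]

lemma base_pos : {y | (((1/6 : ℝ), (1/6 : ℝ), (1/6 : ℝ)), y) ∈ Zset (Ioi 0)}.ncard = 1 := by
  have : {y | (((1/6 : ℝ), (1/6 : ℝ), (1/6 : ℝ)), y) ∈ Zset (Ioi 0)} = {((1:ℝ), (1:ℝ))} := by
    rw [base_Z]; ext y
    simp only [mem_setOf_eq, mem_singleton_iff]
    constructor
    · rintro ⟨rfl | rfl | rfl | rfl, h⟩
      · rfl
      all_goals norm_num [Jac] at h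
    · rintro rfl
      norm_num [Jac]
  rw [this, Set.ncard_singleton]

lemma base_neg : {y | (((1/6 : ℝ), (1/6 : ℝ), (1/6 : ℝ)), y) ∈ Zset (Iio 0)}.ncard = 3 := by
  have : {y | (((1/6 : ℝ), (1/6 : ℝ), (1/6 : ℝ)), y) ∈ Zset (Iio 0)} =
      (({(1/2, 1/2), (1, 2), (2, 1)} : Finset (ℝ × ℝ)) : Set (ℝ × ℝ)) := by
    rw [base_Z]; ext y
    simp only [mem_setOf_eq, Finset.coe_insert, Finset.coe_singleton, mem_insert_iff,
      mem_singleton_iff]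
    constructor
    · rintro ⟨rfl | h, h'⟩
      · norm_num [Jac] at h'
      · exact h
    · rintro (rfl | rfl | rfl) <;> norm_num [Jac]
  rw [this, Set.ncard_coe_finset]
  norm_num [Finset.card_insert_of_notMem]

theorem component_O1_singular_points :
    ∀ p ∈ connectedComponentIn Uset ((1/6 : ℝ), (1/6 : ℝ), (1/6 : ℝ)),
      ({xy : ℝ × ℝ | 0 < xy.1 ∧ 0 < xy.2 ∧ eqS1 p.1 p.2.1 p.2.2 xy.1 xy.2 1 ∧ eqS2 p.1 p.2.1 p.2.2 xy.1 xy.2 1}).ncard = 4 ∧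
      ({xy : ℝ × ℝ | 0 < xy.1 ∧ 0 < xy.2 ∧ eqS1 p.1 p.2.1 p.2.2 xy.1 xy.2 1 ∧ eqS2 p.1 p.2.1 p.2.2 xy.1 xy.2 1 ∧ 0 < F2 p.1 p.2.1 p.2.2 xy.1 xy.2 1}).ncard = 1 ∧
      ({xy : ℝ × ℝ | 0 < xy.1 ∧ 0 < xy.2 ∧ eqS1 p.1 p.2.1 p.2.2 xy.1 xy.2 1 ∧ eqS2 p.1 p.2.1 p.2.2 xy.1 xy.2 1 ∧ F2 p.1 p.2.1 p.2.2 xy.1 xy.2 1 < 0}).ncard = 3 := by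
  intro p hp
  have hU : p ∈ Uset := connectedComponentIn_subset _ _ hp
  obtain ⟨a1, a2, a3⟩ := p
  obtain ⟨⟨u1, -⟩, ⟨u2, -⟩, ⟨u3, -⟩, -⟩ := hU
  simp only at u1 u2 u3
  have hA : 0 < a1*a2 + a1*a3 + a2*a3 := by positivity
  have n1 := count_const univ univ isOpen_univ isClosed_univ (subset_refl _)
    (fun t _ _ => mem_univ t) _ _ hp
  have n2 := count_const (Ioi 0) (Ici 0) isOpen_Ioi isClosed_Ici Ioi_subset_Ici_self
    (fun t ht h0 => lt_of_le_of_ne ht (Ne.symm h0)) _ _ hp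
  have n3 := count_const (Iio 0) (Iic 0) isOpen_Iio isClosed_Iic Iio_subset_Iic_self
    (fun t ht h0 => lt_of_le_of_ne ht h0) _ _ hp
  rw [base_univ] at n1
  rw [base_pos] at n2
  rw [base_neg] at n3
  refine ⟨?_, ?_, ?_⟩
  · rw [← n1]
    congr 1
    ext ⟨x, y⟩
    simp only [Zset, mem_setOf_eq, mem_univ, and_true]
    rw [S_iff a1 a2 a3 x y hA]
  · rw [← n2]
    congr 1
    ext ⟨x, y⟩
    simp only [Zset, mem_setOf_eq, mem_Ioi]
    rw [← and_assoc (a := eqS1 _ _ _ _ _ _), S_iff a1 a2 a3 x y hA]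
    constructor
    · rintro ⟨hx, hy, ⟨e1, e2⟩, h⟩
      refine ⟨hx, hy, e1, e2, ?_⟩
      rw [F2_eq _ _ _ _ _ e1 e2] at h
      exact (pos_iff_pos_of_mul_pos h).1 (by positivity)
    · rintro ⟨hx, hy, e1, e2, h⟩
      refine ⟨hx, hy, ⟨e1, e2⟩, ?_⟩
      rw [F2_eq _ _ _ _ _ e1 e2]
      positivity
  · rw [← n3]
    congr 1
    ext ⟨x, y⟩
    simp only [Zset, mem_setOf_eq, mem_Iio]
    rw [← and_assoc (a := eqS1 _ _ _ _ _ _), S_iff a1 a2 a3 x y hA]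
    constructor
    · rintro ⟨hx, hy, ⟨e1, e2⟩, h⟩
      refine ⟨hx, hy, e1, e2, ?_⟩
      rw [F2_eq _ _ _ _ _ e1 e2] at h
      by_contra hn
      push Not at hn
      have : 0 ≤ (a1*a2 + a1*a3 + a2*a3)^2 * (x * y) * Jac a1 a2 a3 x y := by positivity
      linarith
    · rintro ⟨hx, hy, e1, e2, h⟩
      refine ⟨hx, hy, ⟨e1, e2⟩, ?_⟩
      rw [F2_eq _ _ _ _ _ e1 e2]
      exact mul_neg_of_pos_of_neg (by positivity) h
end
end

section
/- Let U = {(a1,a2,a3) ∈ (0,1/2)×(0,1/2)×(0,1/2) : Q(a1,a2,a3) ≠ 0} and let O3 be the connected component of U containing the point (1/6, 1/4, 1/3). Then for every (a1,a2,a3) ∈ O3, the set of pairs (x1,x2) of positive reals such that (x1, x2, 1) satisfies system (S) has exactly two elements, and both satisfy F2(x1,x2,1) < 0 (i.e., both singular points of the reduced planar Ricci flow system are saddles). -/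
noncomputable section
open Real Set

/-- On a solution, `F2` is a multiple of the affine Jacobian of the two conics. -/
lemma F2_eq_s11 (a1 a2 a3 x1 x2 : ℝ)
    (h12 : x2 + a1*(x1^2 - x2^2 - 1) = x1 + a2*(x2^2 - x1^2 - 1))
    (h13 : x2 + a1*(x1^2 - x2^2 - 1) = x1*x2 + a3*(1 - x1^2 - x2^2)) :
    F2 a1 a2 a3 x1 x2 1 = (a1*a2 + a1*a3 + a2*a3)^2*x1*x2*
      ((2*(a1+a2)*x1 - 1)*(1 - 2*a1*x2 - x1 + 2*a3*x2)
        - (1 - 2*(a1+a2)*x2)*(2*a1*x1 - x2 + 2*a3*x1)) := by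
  unfold F2
  simp only []
  linear_combination (a2^2*a3^3*x1^2 - a2^2*a3^3*x2^2 + a1^3*a2^2*x1^2 + 3*a1^3*a3^2*x1^2 - a2^2*a3^3 + 3*a1*a2^2*a3^2*x1^2 + 2*a1^2*a3^3*x1^2 - a1^3*a2^2 + 3*a1^2*a2^2*a3*x1^2 + a1^3*a2^2*x2^2 + 3*a1^2*a2^2*a3*x2^2 + a1^3*a3^2*x2^2 - a1^3*a3^2 + 2*a1^3*a2*a3*x2^2 + 4*a1^3*a2*a3*x1^2 - 2*a1^3*a2*a3 - a1^2*a3^2*x1*x2 + 4*a1*a2*a3^3*x1^2 - 3*a1^2*a2^2*a3 + 3*a1^2*a2*a3^2*x2^2 + 9*a1^2*a2*a3^2*x1^2 - 3*a1^2*a2*a3^2 - 2*a1*a2*a3^3 + a1*a2^2*a3^2*x2^2 - 3*a1*a2^2*a3^2 - 2*a1^2*a2*a3*x1*x2 - a1^2*a3^2*x1 - 2*a1*a2*a3^2*x1*x2) * h12 + (a2^2*a3^2*x1 - 2*a2^3*a3^2*x2^2 - 2*a2^3*a3^2*x1^2 + a1^3*a2^2 - a1^3*a2^2*x2^2 - a1^3*a2^2*x1^2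 + a1^3*a3^2 - a1^3*a3^2*x2^2 - 3*a1^3*a3^2*x1^2 + a2^2*a3^2*x2 + 2*a1^2*a3^2*x1 + a1^2*a2^2*x1 - 2*a1^2*a2^3*x1^2 + 2*a1^3*a2*a3 - 2*a1^3*a2*a3*x2^2 - 4*a1^3*a2*a3*x1^2 + 4*a1*a2*a3^2*x1 + 2*a1*a2^2*a3*x1 - 4*a1*a2^2*a3^2*x2^2 - 8*a1*a2^2*a3^2*x1^2 - 2*a1*a2^3*a3*x2^2 - 4*a1*a2^3*a3*x1^2 + 3*a1^2*a2*a3^2 - 3*a1^2*a2*a3^2*x2^2 - 9*a1^2*a2*a3^2*x1^2 + 3*a1^2*a2^2*a3 - 3*a1^2*a2^2*a3*x2^2 - 7*a1^2*a2^2*a3*x1^2 + 2*a1^2*a2*a3*x1 - a1^2*a2^2*x1*x2) * h13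

set_option maxHeartbeats 2000000 in
/-- A pair of conics `u v = w`, `A u² + D u + F + E v + C v² = 0`, first case `w ≠ 0`. -/
lemma conics_case1 (A C D E F w : ℝ) (hA : 0 < A) (hC : C < 0) (hw : w ≠ 0)
    (hdisc : 256*A^3*C^3*w^4 - 192*A^2*D*E*C^2*w^3 - 128*A^2*F^2*C^2*w^2 + 144*A^2*F*E^2*C*w^2
      - 27*A^2*E^4*w^2 + 144*A*D^2*F*C^2*w^2 - 6*A*D^2*E^2*C*w^2 - 80*A*D*F^2*E*C*w
      + 18*A*D*F*E^3*w + 16*A*F^4*C - 4*A*F^3*E^2 - 27*D^4*C^2*w^2 + 18*D^3*F*E*C*w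
      - 4*D^3*E^3*w - 4*D^2*F^3*C + D^2*F^2*E^2 < 0) :
    ∃ u1 v1 u2 v2 : ℝ, (u1, v1) ≠ (u2, v2) ∧
      (∀ u v : ℝ, (u*v = w ∧ A*u^2 + D*u + F + E*v + C*v^2 = 0) ↔
        ((u = u1 ∧ v = v1) ∨ (u = u2 ∧ v = v2))) ∧
      0 < 2*A*u1^2 + D*u1 - 2*C*v1^2 - E*v1 ∧ 0 < 2*A*u2^2 + D*u2 - 2*C*v2^2 - E*v2 := by
  have hw2 : 0 < w^2 := by positivity
  have hcont : Continuous (fun u : ℝ => A*u^4 + D*u^3 + F*u^2 + E*w*u + C*w^2) := by fun_prop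
  have h0 : A*(0:ℝ)^4 + D*0^3 + F*0^2 + E*w*0 + C*w^2 < 0 := by nlinarith
  -- a large radius at which the quartic is positive
  obtain ⟨R, hR0, hRp, hRn⟩ : ∃ R : ℝ, 0 < R ∧
      0 ≤ A*R^4 + D*R^3 + F*R^2 + E*w*R + C*w^2 ∧
      0 ≤ A*(-R)^4 + D*(-R)^3 + F*(-R)^2 + E*w*(-R) + C*w^2 := by
    set M := |D| + |F| + |E*w| + |C*w^2| with hM
    have hMD := abs_nonneg D
    have hMF := abs_nonneg F
    have hME := abs_nonneg (E*w)
    have hMC := abs_nonneg (C*w^2)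
    have hM0 : 0 ≤ M := by positivity
    have key : ∀ d e : ℝ, |d| = |D| → |e| = |E*w| →
        0 ≤ A*(1 + M/A)^4 + d*(1 + M/A)^3 + F*(1 + M/A)^2 + e*(1 + M/A) + C*w^2 := by
      intro d e hd he
      set R := 1 + M/A with hR
      have hR1 : 1 ≤ R := by
        have : 0 ≤ M/A := by positivity
        linarith
      have hAR : A*R = A + M := by rw [hR]; field_simp
      have h2 : 1 ≤ R^2 := one_le_pow₀ hR1
      have h3 : 1 ≤ R^3 := one_le_pow₀ hR1
      have h23 : R^2 ≤ R^3 := pow_le_pow_right₀ hR1 (by norm_num)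
      have h13 : R ≤ R^3 := by
        calc R = R^1 := (pow_one R).symm
          _ ≤ R^3 := pow_le_pow_right₀ hR1 (by norm_num)
      have e4 : A*R^4 = (A + M)*R^3 := by rw [← hAR]; ring
      have i1 : -(|D| * R^3) ≤ d*R^3 := by
        rw [← hd, ← neg_mul]; exact mul_le_mul_of_nonneg_right (neg_abs_le d) (by linarith)
      have i2 : -(|F| * R^3) ≤ F*R^2 := by
        have : |F| * R^2 ≤ |F| * R^3 := mul_le_mul_of_nonneg_left h23 hMF
        have : -|F| * R^2 ≤ F*R^2 := mul_le_mul_of_nonneg_right (neg_abs_le F) (by linarith)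
        linarith
      have i3 : -(|E*w| * R^3) ≤ e*R := by
        have h1 : |E*w| * R ≤ |E*w| * R^3 := mul_le_mul_of_nonneg_left h13 hME
        have : -|e| * R ≤ e*R := mul_le_mul_of_nonneg_right (neg_abs_le e) (by linarith)
        rw [he] at this
        linarith
      have i4 : -(|C*w^2| * R^3) ≤ C*w^2 := by
        have h1 : |C*w^2| * 1 ≤ |C*w^2| * R^3 := mul_le_mul_of_nonneg_left h3 hMC
        have := neg_abs_le (C*w^2)
        linarith
      have hAR3 : 0 ≤ A*R^3 := by positivity
      have : (A + M)*R^3 = A*R^3 + |D| * R^3 + |F| * R^3 + |E*w| * R^3 + |C*w^2| * R^3 := by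
        rw [hM]; ring
      linarith
    refine ⟨1 + M/A, by positivity, key D (E*w) rfl rfl, ?_⟩
    have := key (-D) (-(E*w)) (abs_neg _) (abs_neg _)
    linarith [this]
  obtain ⟨r, hr, hr0⟩ := intermediate_value_Icc hR0.le hcont.continuousOn ⟨h0.le, hRp⟩
  obtain ⟨t, ht, ht0⟩ := intermediate_value_Icc' (neg_nonpos.mpr hR0.le) hcont.continuousOn
    ⟨h0.le, hRn⟩
  simp only [] at hr0 ht0
  have hrpos : 0 < r := by
    rcases hr.1.lt_or_eq with h | h
    · exact h
    · rw [← h] at hr0; linarith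
  have htneg : t < 0 := by
    rcases ht.2.lt_or_eq with h | h
    · exact h
    · rw [h] at ht0; linarith
  -- factor the quartic
  obtain ⟨β, γ, hD, hF, hE, hCC⟩ : ∃ β γ : ℝ, D = β - (r+t)*A ∧ F = γ - (r+t)*β + r*t*A ∧
      E*w = -(r+t)*γ + r*t*β ∧ C*w^2 = r*t*γ := by
    have hne : r - t ≠ 0 := by linarith
    set β := D + (r+t)*A with hβ
    set γ := F + (r+t)*β - r*t*A with hγ
    have e1 : (E*w + (r+t)*γ - r*t*β) = 0 := by
      apply mul_left_cancel₀ hne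
      rw [hγ, hβ]
      linear_combination hr0 - ht0
    refine ⟨β, γ, by rw [hβ]; ring, by rw [hγ]; ring, by linarith, ?_⟩
    rw [hγ, hβ] at *
    linear_combination hr0 - r * e1
  have hq : β^2 - 4*A*γ < 0 := by
    by_contra hcon
    push Not at hcon
    have hid : w^2 * (256*A^3*C^3*w^4 - 192*A^2*D*E*C^2*w^3 - 128*A^2*F^2*C^2*w^2
      + 144*A^2*F*E^2*C*w^2
      - 27*A^2*E^4*w^2 + 144*A*D^2*F*C^2*w^2 - 6*A*D^2*E^2*C*w^2 - 80*A*D*F^2*E*C*w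
      + 18*A*D*F*E^3*w + 16*A*F^4*C - 4*A*F^3*E^2 - 27*D^4*C^2*w^2 + 18*D^3*F*E*C*w
      - 4*D^3*E^3*w - 4*D^2*F^3*C + D^2*F^2*E^2)
      = (r-t)^2 * (β^2 - 4*A*γ) * ((A*r^2+β*r+γ)*(A*t^2+β*t+γ))^2 := by
      have : w^2 * (256*A^3*C^3*w^4 - 192*A^2*D*E*C^2*w^3 - 128*A^2*F^2*C^2*w^2
        + 144*A^2*F*E^2*C*w^2
        - 27*A^2*E^4*w^2 + 144*A*D^2*F*C^2*w^2 - 6*A*D^2*E^2*C*w^2 - 80*A*D*F^2*E*C*w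
        + 18*A*D*F*E^3*w + 16*A*F^4*C - 4*A*F^3*E^2 - 27*D^4*C^2*w^2 + 18*D^3*F*E*C*w
        - 4*D^3*E^3*w - 4*D^2*F^3*C + D^2*F^2*E^2)
        = 256*A^3*(C*w^2)^3 - 192*A^2*D*(E*w)*(C*w^2)^2 - 128*A^2*F^2*(C*w^2)^2
          + 144*A^2*F*(E*w)^2*(C*w^2) - 27*A^2*(E*w)^4 + 144*A*D^2*F*(C*w^2)^2
          - 6*A*D^2*(E*w)^2*(C*w^2) - 80*A*D*F^2*(E*w)*(C*w^2) + 18*A*D*F*(E*w)^3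
          + 16*A*F^4*(C*w^2) - 4*A*F^3*(E*w)^2 - 27*D^4*(C*w^2)^2 + 18*D^3*F*(E*w)*(C*w^2)
          - 4*D^3*(E*w)^3 - 4*D^2*F^3*(C*w^2) + D^2*F^2*(E*w)^2 := by ring
      rw [this, hE, hCC, hF, hD]
      ring
    have hneg := mul_neg_of_pos_of_neg hw2 hdisc
    rw [hid] at hneg
    have : 0 ≤ (r-t)^2 * (β^2 - 4*A*γ) * ((A*r^2+β*r+γ)*(A*t^2+β*t+γ))^2 := by positivity
    linarith
  have hqpos : ∀ u : ℝ, 0 < A*u^2 + β*u + γ := by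
    intro u
    have : 0 < 4*A*(A*u^2 + β*u + γ) := by nlinarith [sq_nonneg (2*A*u + β)]
    exact pos_of_mul_pos_right this (by positivity)
  have hfac : ∀ u v : ℝ, u*v = w →
      u^2*(A*u^2 + D*u + F + E*v + C*v^2) = (u - r)*(u - t)*(A*u^2 + β*u + γ) := by
    intro u v huv
    have : u^2*(A*u^2 + D*u + F + E*v + C*v^2)
        = A*u^4 + D*u^3 + F*u^2 + (E*w)*u + C*w^2 := by rw [← huv]; ring
    rw [this, hE, hCC, hF, hD]; ring
  have hder : ∀ u v : ℝ, u*v = w → u^2*(A*u^2 + D*u + F + E*v + C*v^2) = 0 →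
      u^2*(2*A*u^2 + D*u - 2*C*v^2 - E*v)
        = u*((2*u - r - t)*(A*u^2 + β*u + γ) + (u - r)*(u - t)*(2*A*u + β)) := by
    intro u v huv h0
    have : u^2*(2*A*u^2 + D*u - 2*C*v^2 - E*v)
        = 4*A*u^4 + 3*D*u^3 + 2*F*u^2 + (E*w)*u
          - 2*(u^2*(A*u^2 + D*u + F + E*v + C*v^2)) := by rw [← huv]; ring
    rw [this, h0, hE, hF, hD]; ring
  have hr' : r*(w/r) = w := by field_simp
  have ht' : t*(w/t) = w := by field_simp [htneg.ne]
  have hzero : ∀ u v : ℝ, u*v = w → (u = r ∨ u = t) →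
      A*u^2 + D*u + F + E*v + C*v^2 = 0 := by
    intro u v huv h
    have hu : u ≠ 0 := by
      rintro rfl; simp at huv; exact hw huv.symm
    have h1 := hfac u v huv
    have h2 : (u - r)*(u - t)*(A*u^2 + β*u + γ) = 0 := by
      rcases h with h | h <;> rw [h] <;> ring
    rw [h2] at h1
    exact (mul_eq_zero.mp h1).resolve_left (by positivity)
  refine ⟨r, w/r, t, w/t, ?_, ?_, ?_, ?_⟩
  · intro h
    have := congrArg Prod.fst h
    simp only [] at this
    linarith
  · intro u v
    constructor
    · rintro ⟨huv, hg⟩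
      have hu : u ≠ 0 := by
        rintro rfl; simp at huv; exact hw huv.symm
      have hv : v = w/u := by rw [← huv]; field_simp
      have h1 := hfac u v huv
      rw [hg, mul_zero] at h1
      have h2 := (mul_eq_zero.mp h1.symm).resolve_right (hqpos u).ne'
      rcases mul_eq_zero.mp h2 with h | h
      · have : u = r := by linarith
        subst this; exact Or.inl ⟨rfl, hv⟩
      · have : u = t := by linarith
        subst this; exact Or.inr ⟨rfl, hv⟩
    · rintro (⟨rfl, rfl⟩ | ⟨rfl, rfl⟩)
      · exact ⟨hr', hzero _ _ hr' (Or.inl rfl)⟩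
      · exact ⟨ht', hzero _ _ ht' (Or.inr rfl)⟩
  · have h1 := hder r (w/r) hr' (by rw [hzero _ _ hr' (Or.inl rfl), mul_zero])
    have h2 : 0 < r^2*(2*A*r^2 + D*r - 2*C*(w/r)^2 - E*(w/r)) := by
      rw [h1]
      have : r*((2*r - r - t)*(A*r^2 + β*r + γ) + (r - r)*(r - t)*(2*A*r + β))
        = r*(r - t)*(A*r^2 + β*r + γ) := by ring
      rw [this]
      exact mul_pos (mul_pos hrpos (by linarith)) (hqpos r)
    exact pos_of_mul_pos_right h2 (by positivity)
  · have h1 := hder t (w/t) ht' (by rw [hzero _ _ ht' (Or.inr rfl), mul_zero])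
    have h2 : 0 < t^2*(2*A*t^2 + D*t - 2*C*(w/t)^2 - E*(w/t)) := by
      rw [h1]
      have : t*((2*t - r - t)*(A*t^2 + β*t + γ) + (t - r)*(t - t)*(2*A*t + β))
        = (-t)*(r - t)*(A*t^2 + β*t + γ) := by ring
      rw [this]
      exact mul_pos (mul_pos (by linarith) (by linarith)) (hqpos t)
    exact pos_of_mul_pos_right h2 (by positivity)

/-- A real quadratic with positive leading coefficient and negative value at `0`. -/
lemma quad_roots (A D F : ℝ) (hA : 0 < A) (hF : F < 0) :
    ∃ r t : ℝ, 0 < r ∧ t < 0 ∧ D = -A*(r+t) ∧ F = A*(r*t) := by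
  have hpos : 0 < D^2 - 4*A*F := by nlinarith [sq_nonneg D, mul_pos hA (neg_pos.mpr hF)]
  set S := Real.sqrt (D^2 - 4*A*F) with hS
  have hSS : S^2 = D^2 - 4*A*F := Real.sq_sqrt hpos.le
  have hlt : |D| < S := by
    apply abs_lt_of_sq_lt_sq _ (Real.sqrt_nonneg _)
    rw [hSS]; nlinarith [mul_pos hA (neg_pos.mpr hF)]
  have h1 := abs_lt.mp hlt
  refine ⟨(-D + S)/(2*A), (-D - S)/(2*A), ?_, ?_, ?_, ?_⟩
  · apply div_pos <;> linarith
  · apply div_neg_of_neg_of_pos <;> linarith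
  · field_simp; ring
  · field_simp; linarith [hSS]

/-- Second case `w = 0`, in which the first conic is a pair of lines. -/
lemma conics_case2 (A C D E F : ℝ) (hA : 0 < A) (hC : C < 0)
    (hdisc : 16*A*F^4*C - 4*A*F^3*E^2 - 4*D^2*F^3*C + D^2*F^2*E^2 < 0) :
    ∃ u1 v1 u2 v2 : ℝ, (u1, v1) ≠ (u2, v2) ∧
      (∀ u v : ℝ, (u*v = 0 ∧ A*u^2 + D*u + F + E*v + C*v^2 = 0) ↔
        ((u = u1 ∧ v = v1) ∨ (u = u2 ∧ v = v2))) ∧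
      0 < 2*A*u1^2 + D*u1 - 2*C*v1^2 - E*v1 ∧ 0 < 2*A*u2^2 + D*u2 - 2*C*v2^2 - E*v2 := by
  have hprod : F^2*((D^2 - 4*A*F)*(E^2 - 4*C*F)) < 0 := by linarith
  have hFne : F ≠ 0 := by rintro rfl; simp at hprod
  have hF2 : 0 < F^2 := by positivity
  have hp : (D^2 - 4*A*F)*(E^2 - 4*C*F) < 0 := by
    by_contra h
    push Not at h
    nlinarith [mul_nonneg hF2.le h]
  rcases lt_or_gt_of_ne hFne with hF | hF
  · obtain ⟨r, t, hr, ht, rfl, rfl⟩ := quad_roots A D F hA hF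
    have h1 : 0 < (-A*(r+t))^2 - 4*A*(A*(r*t)) := by
      nlinarith [sq_nonneg (A*(r+t)), mul_pos hA (neg_pos.mpr hF)]
    have h2 : E^2 - 4*C*(A*(r*t)) < 0 := by
      by_contra h
      push Not at h
      nlinarith [mul_nonneg h1.le h]
    have hno : ∀ v : ℝ, A*(r*t) + E*v + C*v^2 ≠ 0 := by
      intro v hv
      nlinarith [sq_nonneg (2*C*v + E)]
    refine ⟨r, 0, t, 0, ?_, ?_, ?_, ?_⟩
    · intro h
      have := congrArg Prod.fst h
      simp only [] at this
      linarith
    · intro u v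
      constructor
      · rintro ⟨huv, hg⟩
        rcases mul_eq_zero.mp huv with rfl | rfl
        · exact absurd (by linarith) (hno v)
        · have : A*((u - r)*(u - t)) = 0 := by linarith
          rcases mul_eq_zero.mp ((mul_eq_zero.mp this).resolve_left hA.ne') with h | h
          · exact Or.inl ⟨by linarith, rfl⟩
          · exact Or.inr ⟨by linarith, rfl⟩
      · rintro (⟨rfl, rfl⟩ | ⟨rfl, rfl⟩) <;> exact ⟨by ring, by ring⟩
    · have : 0 < A*r*(r - t) := mul_pos (mul_pos hA hr) (by linarith)
      linarith
    · have : 0 < A*(-t)*(r - t) := mul_pos (mul_pos hA (by linarith)) (by linarith)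
      linarith
  · obtain ⟨r, t, hr, ht, hE, hFF⟩ := quad_roots (-C) (-E) (-F) (by linarith) (by linarith)
    have hE' : E = -C*(r+t) := by linarith
    have hF' : F = C*(r*t) := by linarith
    have h1 : 0 < E^2 - 4*C*F := by
      nlinarith [sq_nonneg E, mul_pos (neg_pos.mpr hC) hF]
    have h2 : D^2 - 4*A*F < 0 := by
      by_contra h
      push Not at h
      nlinarith [mul_nonneg h h1.le]
    have hno : ∀ u : ℝ, A*u^2 + D*u + F ≠ 0 := by
      intro u hu
      nlinarith [sq_nonneg (2*A*u + D)]
    refine ⟨0, r, 0, t, ?_, ?_, ?_, ?_⟩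
    · intro h
      have := congrArg Prod.snd h
      simp only [] at this
      linarith
    · intro u v
      constructor
      · rintro ⟨huv, hg⟩
        rcases mul_eq_zero.mp huv with rfl | rfl
        · have : C*((v - r)*(v - t)) = 0 := by rw [hE', hF'] at hg; linarith
          rcases mul_eq_zero.mp ((mul_eq_zero.mp this).resolve_left hC.ne) with h | h
          · exact Or.inl ⟨rfl, by linarith⟩
          · exact Or.inr ⟨rfl, by linarith⟩
        · exact absurd (by linarith) (hno u)
      · rintro (⟨rfl, rfl⟩ | ⟨rfl, rfl⟩) <;> exact ⟨by ring, by rw [hE', hF']; ring⟩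
    · have : 0 < (-C)*r*(r - t) := mul_pos (mul_pos (by linarith) hr) (by linarith)
      rw [hE']; linarith
    · have : 0 < (-C)*(-t)*(r - t) := mul_pos (mul_pos (by linarith) (by linarith)) (by linarith)
      rw [hE']; linarith

/-- The two cases together. -/
lemma conics (A C D E F w : ℝ) (hA : 0 < A) (hC : C < 0)
    (hdisc : 256*A^3*C^3*w^4 - 192*A^2*D*E*C^2*w^3 - 128*A^2*F^2*C^2*w^2 + 144*A^2*F*E^2*C*w^2
      - 27*A^2*E^4*w^2 + 144*A*D^2*F*C^2*w^2 - 6*A*D^2*E^2*C*w^2 - 80*A*D*F^2*E*C*w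
      + 18*A*D*F*E^3*w + 16*A*F^4*C - 4*A*F^3*E^2 - 27*D^4*C^2*w^2 + 18*D^3*F*E*C*w
      - 4*D^3*E^3*w - 4*D^2*F^3*C + D^2*F^2*E^2 < 0) :
    ∃ u1 v1 u2 v2 : ℝ, (u1, v1) ≠ (u2, v2) ∧
      (∀ u v : ℝ, (u*v = w ∧ A*u^2 + D*u + F + E*v + C*v^2 = 0) ↔
        ((u = u1 ∧ v = v1) ∨ (u = u2 ∧ v = v2))) ∧
      0 < 2*A*u1^2 + D*u1 - 2*C*v1^2 - E*v1 ∧ 0 < 2*A*u2^2 + D*u2 - 2*C*v2^2 - E*v2 := by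
  by_cases hw : w = 0
  · subst hw
    exact conics_case2 A C D E F hA hC (by linarith)
  · exact conics_case1 A C D E F w hA hC hw hdisc

/-- The system (S) says that the three Ricci-type quadrics agree. -/
lemma sys_iff (a1 a2 a3 x1 x2 : ℝ) (h1 : 0 < a1) (h2 : 0 < a2) (h3 : 0 < a3) :
    (eqS1 a1 a2 a3 x1 x2 1 ∧ eqS2 a1 a2 a3 x1 x2 1) ↔
    (x2 + a1*(x1^2 - x2^2 - 1) = x1 + a2*(x2^2 - x1^2 - 1) ∧
     x2 + a1*(x1^2 - x2^2 - 1) = x1*x2 + a3*(1 - x1^2 - x2^2)) := by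
  unfold eqS1 eqS2
  have hA : a1*a2 + a1*a3 + a2*a3 ≠ 0 := by positivity
  constructor
  · rintro ⟨e1, e2⟩
    constructor
    · apply mul_left_cancel₀ hA
      linear_combination -a1 * e1 + a2 * e2
    · apply mul_left_cancel₀ hA
      linear_combination -(a1 + a3) * e1 - a3 * e2
  · rintro ⟨e1, e2⟩
    constructor
    · linear_combination -a3 * e1 - a2 * e2
    · linear_combination (a3 + a1) * e1 - a1 * e2

/-- No solution has exactly one coordinate of the opposite sign. -/
lemma no_mixed (a b c x y z : ℝ) (ha : 0 < a) (hb : 0 < b) (hc : 0 < c)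
    (ha' : a < 1/2) (hb' : b < 1/2) (hc' : c < 1/2) (hx : 0 < x) (hy : 0 < y) (hz : 0 < z)
    (h1 : -(y*z) + a*(x^2 - y^2 - z^2) = -(x*z) + b*(y^2 - x^2 - z^2))
    (h2 : -(y*z) + a*(x^2 - y^2 - z^2) = x*y + c*(z^2 - x^2 - y^2)) : False := by
  by_cases h : z < x - y
  · have p1 : 0 < (x - y)*z := mul_pos (by linarith) hz
    have p2 : 0 < a*(x^2 - y^2 - z^2) := mul_pos ha (by nlinarith)
    have p3 : 0 < b*(x^2 + z^2 - y^2) := mul_pos hb (by nlinarith)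
    linarith
  by_cases h' : z < y - x
  · have p1 : 0 < (y - x)*z := mul_pos (by linarith) hz
    have p2 : 0 < b*(y^2 - x^2 - z^2) := mul_pos hb (by nlinarith)
    have p3 : 0 < a*(y^2 + z^2 - x^2) := mul_pos ha (by nlinarith)
    linarith
  push Not at h h'
  have hxy : 0 < x*y := mul_pos hx hy
  have q3 : 0 < x*y + c*(z^2 - x^2 - y^2) := by
    by_cases hz2 : 0 ≤ z^2 - x^2 - y^2
    · have := mul_nonneg hc.le hz2
      linarith
    · push Not at hz2
      have e1 : 0 < (1/2 - c)*(-(z^2 - x^2 - y^2)) := mul_pos (by linarith) (by linarith)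
      have e2 : 0 ≤ (z - (x - y))*(z + (x - y)) := mul_nonneg (by linarith) (by linarith)
      linarith
  have p1 : 0 < a*(x^2 - y^2 - z^2) := by
    have := mul_pos hy hz
    linarith
  have p2 : 0 < b*(y^2 - x^2 - z^2) := by
    have := mul_pos hx hz
    linarith
  have r1 := pos_of_mul_pos_right p1 ha.le
  have r2 := pos_of_mul_pos_right p2 hb.le
  nlinarith

/-- All affine real solutions are positive. -/
lemma sol_pos (a b c x y : ℝ) (ha : 0 < a) (hb : 0 < b) (hc : 0 < c)
    (ha' : a < 1/2) (hb' : b < 1/2) (hc' : c < 1/2)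
    (h1 : y + a*(x^2 - y^2 - 1) = x + b*(y^2 - x^2 - 1))
    (h2 : y + a*(x^2 - y^2 - 1) = x*y + c*(1 - x^2 - y^2)) : 0 < x ∧ 0 < y := by
  rcases lt_trichotomy x 0 with hx | hx | hx
  · exfalso
    rcases lt_trichotomy y 0 with hy | hy | hy
    · exact no_mixed a b c (-x) (-y) 1 ha hb hc ha' hb' hc' (by linarith) (by linarith)
        one_pos (by linarith) (by linarith)
    · subst hy
      have e : (a + c)*(x^2 - 1) = 0 := by linarith
      have e2 : x^2 - 1 = 0 := (mul_eq_zero.mp e).resolve_left (by positivity)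
      have e3 : x = 2*b := by linear_combination h1 * (-1) + (a + b) * e2
      linarith
    · exact no_mixed b c a y 1 (-x) hb hc ha hb' hc' ha' hy one_pos (by linarith)
        (by linarith) (by linarith)
  · exfalso
    subst hx
    have e : (b + c)*(y^2 - 1) = 0 := by linarith
    have e2 : y^2 - 1 = 0 := (mul_eq_zero.mp e).resolve_left (by positivity)
    have e3 : y = 2*a := by linear_combination h1 + (a + b) * e2
    rw [e3] at e2
    nlinarith
  · rcases lt_trichotomy y 0 with hy | hy | hy
    · exfalso
      exact no_mixed a c b x 1 (-y) ha hc hb ha' hc' hb' hx one_pos (by linarith)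
        (by linarith) (by linarith)
    · exfalso
      subst hy
      have e : (a + c)*(x^2 - 1) = 0 := by linarith
      have e2 : x^2 - 1 = 0 := (mul_eq_zero.mp e).resolve_left (by positivity)
      have e3 : x = 2*b := by linear_combination h1 * (-1) + (a + b) * e2
      rw [e3] at e2
      nlinarith
    · exact ⟨hx, hy⟩

set_option maxHeartbeats 2000000 in
lemma Q_id (a1 a2 a3 A C D E F w s : ℝ) (hs : s = a1 + a2) (hw : w = a1 - a2)
    (hA : A = (1 + 2*a3)*s^2) (hC : C = -(1 - 2*a3)) (hD : D = 2*w*s)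
    (hE : E = -2*(1 - 2*a3 - s))
    (hF : F = -(1 - 2*a3) + 2*s + 2*w^2*s - 4*a3*s^2 - 2*s^3) :
    256*A^3*C^3*w^4 - 192*A^2*D*E*C^2*w^3 - 128*A^2*F^2*C^2*w^2 + 144*A^2*F*E^2*C*w^2
      - 27*A^2*E^4*w^2 + 144*A*D^2*F*C^2*w^2 - 6*A*D^2*E^2*C*w^2 - 80*A*D*F^2*E*C*w
      + 18*A*D*F*E^3*w + 16*A*F^4*C - 4*A*F^3*E^2 - 27*D^4*C^2*w^2 + 18*D^3*F*E*C*w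
      - 4*D^3*E^3*w - 4*D^2*F^3*C + D^2*F^2*E^2 = -(16*s^4) * Qpoly a1 a2 a3 := by
  subst hA hC hD hE hF hs hw
  unfold Qpoly
  simp only []
  ring

/-- The statement for all parameters in the cube with `Q > 0`. -/
lemma main_of_pos (a1 a2 a3 : ℝ) (h1 : 0 < a1) (h2 : 0 < a2) (h3 : 0 < a3)
    (h1' : a1 < 1/2) (h2' : a2 < 1/2) (h3' : a3 < 1/2) (hQ : 0 < Qpoly a1 a2 a3) :
    ({xy : ℝ × ℝ | 0 < xy.1 ∧ 0 < xy.2 ∧ eqS1 a1 a2 a3 xy.1 xy.2 1 ∧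
      eqS2 a1 a2 a3 xy.1 xy.2 1}).ncard = 2 ∧
    ∀ xy ∈ {xy : ℝ × ℝ | 0 < xy.1 ∧ 0 < xy.2 ∧ eqS1 a1 a2 a3 xy.1 xy.2 1 ∧
      eqS2 a1 a2 a3 xy.1 xy.2 1}, F2 a1 a2 a3 xy.1 xy.2 1 < 0 := by
  have hspos : 0 < a1 + a2 := by positivity
  have hdisc := Q_id a1 a2 a3 _ _ _ _ _ _ _ rfl rfl rfl rfl rfl rfl rfl
  obtain ⟨u1, v1, u2, v2, hne, hsol, hT1, hT2⟩ :=
    conics ((1 + 2*a3)*(a1+a2)^2) (-(1 - 2*a3)) (2*(a1-a2)*(a1+a2)) (-2*(1 - 2*a3 - (a1+a2)))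
      (-(1 - 2*a3) + 2*(a1+a2) + 2*(a1-a2)^2*(a1+a2) - 4*a3*(a1+a2)^2 - 2*(a1+a2)^3) (a1-a2)
      (by positivity) (by linarith)
      (by rw [hdisc]
          have : 0 < 16*(a1+a2)^4*Qpoly a1 a2 a3 := by positivity
          linarith)
  -- the affine change of coordinates
  have hiff : ∀ x y : ℝ, (0 < x ∧ 0 < y ∧ eqS1 a1 a2 a3 x y 1 ∧ eqS2 a1 a2 a3 x y 1) ↔
      ((x - y = u1 ∧ (a1+a2)*(x+y) - 1 = v1) ∨ (x - y = u2 ∧ (a1+a2)*(x+y) - 1 = v2)) := by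
    intro x y
    rw [← hsol (x - y) ((a1+a2)*(x+y) - 1), sys_iff a1 a2 a3 x y h1 h2 h3]
    constructor
    · rintro ⟨_, _, e1, e2⟩
      refine ⟨by linear_combination e1, ?_⟩
      linear_combination (-2*(a1+a2)^2 - 2*(a1-a2)*(a1+a2)) * e1 + 4*(a1+a2)^2 * e2
    · rintro ⟨e1, e2⟩
      have e1' : y + a1*(x^2 - y^2 - 1) = x + a2*(y^2 - x^2 - 1) := by linear_combination e1
      have e2' : y + a1*(x^2 - y^2 - 1) = x*y + a3*(1 - x^2 - y^2) := by
        have h4 : 4*(a1+a2)^2 ≠ 0 := by positivity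
        apply mul_left_cancel₀ h4
        linear_combination e2 + (2*(a1+a2)^2 + 2*(a1-a2)*(a1+a2)) * e1'
      obtain ⟨hx, hy⟩ := sol_pos a1 a2 a3 x y h1 h2 h3 h1' h2' h3' e1' e2'
      exact ⟨hx, hy, e1', e2'⟩
  have hset : {xy : ℝ × ℝ | 0 < xy.1 ∧ 0 < xy.2 ∧ eqS1 a1 a2 a3 xy.1 xy.2 1 ∧
      eqS2 a1 a2 a3 xy.1 xy.2 1} =
      {(((v1+1)/(a1+a2) + u1)/2, ((v1+1)/(a1+a2) - u1)/2),
       (((v2+1)/(a1+a2) + u2)/2, ((v2+1)/(a1+a2) - u2)/2)} := by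
    have aux : ∀ x y u v : ℝ, (x - y = u ∧ (a1+a2)*(x+y) - 1 = v) ↔
        (x = ((v+1)/(a1+a2) + u)/2 ∧ y = ((v+1)/(a1+a2) - u)/2) := by
      intro x y u v
      constructor
      · rintro ⟨rfl, rfl⟩
        constructor <;> field_simp <;> ring
      · rintro ⟨rfl, rfl⟩
        constructor
        · ring
        · field_simp; ring
    ext ⟨x, y⟩
    simp only [mem_ofPred_eq, mem_insert_iff, mem_singleton_iff, Prod.mk.injEq]
    rw [hiff, aux, aux]
  constructor
  · rw [hset]
    apply Set.ncard_pair
    intro h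
    apply hne
    have e1 := congrArg Prod.fst h
    have e2 := congrArg Prod.snd h
    simp only [] at e1 e2
    have hu : u1 = u2 := by linarith
    have hv : (v1+1)/(a1+a2) = (v2+1)/(a1+a2) := by linarith
    have hv' : v1 = v2 := by
      have := (div_left_inj' hspos.ne').mp hv
      linarith
    rw [hu, hv']
  · rintro ⟨x, y⟩ hxy
    simp only [mem_ofPred_eq] at hxy
    obtain ⟨hx, hy, e1, e2⟩ := hxy
    obtain ⟨e1', e2'⟩ := (sys_iff a1 a2 a3 x y h1 h2 h3).mp ⟨e1, e2⟩
    simp only []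
    rw [F2_eq_s11 a1 a2 a3 x y e1' e2']
    have hT : 0 < 2*((1 + 2*a3)*(a1+a2)^2)*(x-y)^2 + (2*(a1-a2)*(a1+a2))*(x-y)
        - 2*(-(1 - 2*a3))*((a1+a2)*(x+y) - 1)^2
        - (-2*(1 - 2*a3 - (a1+a2)))*((a1+a2)*(x+y) - 1) := by
      rcases (hiff x y).mp ⟨hx, hy, e1, e2⟩ with ⟨hu, hv⟩ | ⟨hu, hv⟩
      · rw [hu, hv]; exact hT1
      · rw [hu, hv]; exact hT2
    have hJ : ((2*(a1+a2)*x - 1)*(1 - 2*a1*y - x + 2*a3*y)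
        - (1 - 2*(a1+a2)*y)*(2*a1*x - y + 2*a3*x)) < 0 := by
      have : 0 < 2*(a1+a2) * -((2*(a1+a2)*x - 1)*(1 - 2*a1*y - x + 2*a3*y)
        - (1 - 2*(a1+a2)*y)*(2*a1*x - y + 2*a3*x)) := by
        convert hT using 1
        ring
      have := pos_of_mul_pos_right this (by positivity)
      linarith
    exact mul_neg_of_pos_of_neg (by positivity) hJ

theorem component_O3_singular_points :
    ∀ p ∈ connectedComponentIn Uset ((1/6 : ℝ), (1/4 : ℝ), (1/3 : ℝ)),
      ({xy : ℝ × ℝ | 0 < xy.1 ∧ 0 < xy.2 ∧ eqS1 p.1 p.2.1 p.2.2 xy.1 xy.2 1 ∧ eqS2 p.1 p.2.1 p.2.2 xy.1 xy.2 1}).ncard = 2 ∧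
      ∀ xy ∈ {xy : ℝ × ℝ | 0 < xy.1 ∧ 0 < xy.2 ∧ eqS1 p.1 p.2.1 p.2.2 xy.1 xy.2 1 ∧ eqS2 p.1 p.2.1 p.2.2 xy.1 xy.2 1},
        F2 p.1 p.2.1 p.2.2 xy.1 xy.2 1 < 0 := by
  intro p hp
  have hsub := connectedComponentIn_subset Uset ((1/6 : ℝ), (1/4 : ℝ), (1/3 : ℝ))
  have hmem0 : ((1/6 : ℝ), (1/4 : ℝ), (1/3 : ℝ)) ∈ Uset := by
    simp only [Uset, Qpoly, mem_ofPred_eq, mem_Ioo]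
    norm_num
  have hpre : IsPreconnected (connectedComponentIn Uset ((1/6 : ℝ), (1/4 : ℝ), (1/3 : ℝ))) :=
    isPreconnected_connectedComponentIn
  have hbase := mem_connectedComponentIn hmem0
  have hcont : Continuous (fun q : ℝ × ℝ × ℝ => Qpoly q.1 q.2.1 q.2.2) := by
    unfold Qpoly
    simp only []
    fun_prop
  have hU := hsub hp
  obtain ⟨⟨h1, h1'⟩, ⟨h2, h2'⟩, ⟨h3, h3'⟩, hne⟩ := hU
  have hQ : 0 < Qpoly p.1 p.2.1 p.2.2 := by
    by_contra hcon
    push Not at hcon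
    have hpos0 : (0:ℝ) ≤ Qpoly (1/6) (1/4) (1/3) := by
      unfold Qpoly
      norm_num
    obtain ⟨q, hq, hq0⟩ := hpre.intermediate_value hp hbase hcont.continuousOn ⟨hcon, hpos0⟩
    exact (hsub hq).2.2.2 hq0
  exact main_of_pos p.1 p.2.1 p.2.2 h1 h2 h3 h1' h2' h3' hQ
end
end

section
/- If a1, a2, a3 ∈ [0, 1/2] satisfy a1 + a2 + a3 = 3/4 and Q(a1, a2, a3) = 0, then a1 = a2 = a3 = 1/4. (That is, (1/4, 1/4, 1/4) is the only point of the degeneration set Ω = {Q = 0} in the cube [0,1/2]^3 lying on the plane a1 + a2 + a3 = 3/4.) -/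
noncomputable section
open Real Set

/-- Schur's inequality of degree one, for ordered variables. -/
lemma schur_ordered (x y z : ℝ) (hz : 0 ≤ z) (hyz : z ≤ y) (hxy : y ≤ x) :
    0 ≤ x*(x-y)*(x-z) + y*(y-x)*(y-z) + z*(z-x)*(z-y) := by
  have h1 : 0 ≤ z*((x-z)*(y-z)) :=
    mul_nonneg hz (mul_nonneg (by linarith) (by linarith))
  have h2 : 0 ≤ (x-y)^2*(x+y-z) := mul_nonneg (sq_nonneg _) (by linarith)
  nlinarith

lemma schur_any (x y z : ℝ) (hx : 0 ≤ x) (hy : 0 ≤ y) (hz : 0 ≤ z) :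
    0 ≤ x*(x-y)*(x-z) + y*(y-x)*(y-z) + z*(z-x)*(z-y) := by
  rcases le_total x y with h1 | h1 <;> rcases le_total y z with h2 | h2 <;>
    rcases le_total x z with h3 | h3
  · linarith [schur_ordered z y x hx h1 h2]
  · linarith [schur_ordered z y x hx h1 h2]
  · linarith [schur_ordered y z x hx h3 h2]
  · linarith [schur_ordered y x z hz h3 h1]
  · linarith [schur_ordered z x y hy h1 h3]
  · linarith [schur_ordered x z y hy h2 h3]
  · linarith [schur_ordered x y z hz h2 h1]
  · linarith [schur_ordered x y z hz h2 h1]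

theorem Q_zero_on_sum_three_quarters (a1 a2 a3 : ℝ)
    (ha1 : a1 ∈ Icc (0:ℝ) (1/2)) (ha2 : a2 ∈ Icc (0:ℝ) (1/2)) (ha3 : a3 ∈ Icc (0:ℝ) (1/2))
    (hsum : a1 + a2 + a3 = 3/4) (hQ : Qpoly a1 a2 a3 = 0) :
    a1 = 1/4 ∧ a2 = 1/4 ∧ a3 = 1/4 := by
  obtain ⟨h10, h11⟩ := ha1
  obtain ⟨h20, h21⟩ := ha2
  obtain ⟨h30, h31⟩ := ha3
  have hS := schur_any a1 a2 a3 h10 h20 h30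
  have hv0 : 0 ≤ a1*a2*a3 := by positivity
  have hv2 : 0 ≤ (1/2 - a1)*((1/2 - a2)*(1/2 - a3)) :=
    mul_nonneg (by linarith) (mul_nonneg (by linarith) (by linarith))
  obtain ⟨s2, hs2⟩ : ∃ s, s = a1*a2 + a1*a3 + a2*a3 := ⟨_, rfl⟩
  obtain ⟨s3, hs3⟩ : ∃ s, s = a1*a2*a3 := ⟨_, rfl⟩
  unfold Qpoly at hQ
  simp only [hsum, ← hs2, ← hs3] at hQ
  have hF : (64*s3 + 5 - 32*s2)^2 *
      (576*s2 + 4*(3 - 16*s2)^2 - (64*s3 + 2 - 16*s2)^2) = 0 := by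
    linear_combination 1024 * hQ
  have e3 : a3 = 3/4 - a1 - a2 := by linarith
  have hschur : 0 ≤ 27 - 192*s2 + 576*s3 := by
    rw [hs2, hs3]; subst e3; nlinarith
  have hsq : 9 - 48*s2 = 8*((a1-a2)^2 + (a1-a3)^2 + (a2-a3)^2) := by
    rw [hs2]; subst e3; ring
  have hu2 : s3 ≤ s2/2 - 1/16 := by
    rw [hs2, hs3]; subst e3; nlinarith
  have hp1 := sq_nonneg (a1-a2)
  have hp2 := sq_nonneg (a1-a3)
  have hp3 := sq_nonneg (a2-a3)
  rw [← hs3] at hv0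
  have hpos : 0 < 576*s2 + 4*(3 - 16*s2)^2 - (64*s3 + 2 - 16*s2)^2 := by
    have hq : (64*s3 + 2 - 16*s2)^2 ≤ 2^2 := by
      apply sq_le_sq' <;> linarith
    nlinarith [sq_nonneg (3 - 16*s2)]
  have hlin : 64*s3 + 5 - 32*s2 = 0 := by
    rcases mul_eq_zero.mp hF with h | h
    · exact pow_eq_zero_iff (two_ne_zero) |>.mp h
    · exact absurd h hpos.ne'
  have hz1 : (a1-a2)^2 = 0 := by linarith
  have hz2 : (a1-a3)^2 = 0 := by linarith
  have k1 : a1 - a2 = 0 := pow_eq_zero_iff (two_ne_zero) |>.mp hz1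
  have k2 : a1 - a3 = 0 := pow_eq_zero_iff (two_ne_zero) |>.mp hz2
  refine ⟨by linarith, by linarith, by linarith⟩
end
end
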